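/- arXiv:1407.3553 — 2 statements merged into one kernel-verified Lean document; each statement's English description precedes it below -/
import Mathlib

section
/- Let H ∈ (0, 1/2) and β ∈ [H, 1), and let X ∈ 𝒳^{(H,β)} on [0,T]. Let δ > 0 and N ∈ ℕ with δ·N < T, set Y_k = X_{kδ} − X_{(k−1)δ} for k = 1, …, N, Y = (Y_1, …, Y_N), and I = (Σ_{k=1}^N E[(X_{kδ} − X_{(k−1)δ})²])^{1/2}. Then there exist constants C_1, C_2 > 0, independent of δ, N and T, such that for every h > 0, P( | ‖Y‖_2 − I | ≥ h ) ≤ C_1·exp( − C_2 · h² / δ^{2H} ), where ‖Y‖_2 is the Euclidean norm of Y. -/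
open MeasureTheory ProbabilityTheory

/-- The class `𝒳^{(H,β)}` of centered Gaussian processes on `[0,T]` with
`X_0 = 0`, whose incremental variance function `σ²(s,t) = E[(X_t − X_s)²]` is
differentiable for `s ≠ t` with mixed partial derivative bounded by
`c·|t−s|^{2H−2}` and satisfies `c·|t−s|^{2β} ≤ σ²(s,t) ≤ C·|t−s|^{2H}`. -/
def IsClassX (H β c C T : ℝ) {Ω : Type*} [MeasurableSpace Ω] (P : Measure Ω)
    (X : Ω → ℝ → ℝ) : Prop :=
  (∀ t, Measurable fun ω => X ω t) ∧
  (∀ᵐ ω ∂P, X ω 0 = 0) ∧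
  -- centered Gaussian process
  (∀ (n : ℕ) (t coef : Fin n → ℝ), (∀ i, t i ∈ Set.Icc 0 T) →
    ∃ v : NNReal,
      Measure.map (fun ω => ∑ i, coef i * X ω (t i)) P = gaussianReal 0 v) ∧
  -- σ² is C¹ for s ≠ t with mixed partial derivative bounded by c|t−s|^{2H−2}
  (∃ σ2t σ2st : ℝ → ℝ → ℝ,
    (∀ s t : ℝ, s ∈ Set.Icc 0 T → t ∈ Set.Icc 0 T → s ≠ t →
      HasDerivAt (fun u => ∫ ω, (X ω u - X ω s) ^ 2 ∂P) (σ2t s t) t) ∧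
    (∀ s t : ℝ, s ∈ Set.Icc 0 T → t ∈ Set.Icc 0 T → s ≠ t →
      HasDerivAt (fun u => σ2t u t) (σ2st s t) s) ∧
    (∀ s t : ℝ, s ∈ Set.Icc 0 T → t ∈ Set.Icc 0 T → s ≠ t →
      |σ2st s t| ≤ c * |t - s| ^ (2 * H - 2))) ∧
  -- two-sided bound on the incremental variance
  (∀ s t : ℝ, s ∈ Set.Icc 0 T → t ∈ Set.Icc 0 T →
    c * |t - s| ^ (2 * β) ≤ (∫ ω, (X ω t - X ω s) ^ 2 ∂P) ∧
    (∫ ω, (X ω t - X ω s) ^ 2 ∂P) ≤ C * |t - s| ^ (2 * H))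

theorem one_le_exp_mul_one_sub {x : ℝ} (hx : x ≤ 1 / 2) :
    1 ≤ Real.exp (x + x ^ 2) * (1 - x) := by
  rcases le_total 0 x with h | h
  · have h1 := Real.quadratic_le_exp_of_nonneg (x := x + x ^ 2) (by positivity)
    have h2 : 1 ≤ (1 + (x + x ^ 2) + (x + x ^ 2) ^ 2 / 2) * (1 - x) := by
      nlinarith [mul_nonneg (mul_nonneg h h) (sub_nonneg.2 hx), mul_nonneg h h,
        mul_nonneg (mul_nonneg (mul_nonneg h h) h) (sub_nonneg.2 hx),
        mul_nonneg (mul_nonneg (mul_nonneg (mul_nonneg h h) h) h) (sub_nonneg.2 hx)]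
    exact h2.trans (mul_le_mul_of_nonneg_right h1 (by linarith))
  · have h1 : 0 < 1 - x := by linarith
    have h2 := Real.log_le_sub_one_of_pos (inv_pos.2 h1)
    rw [Real.log_inv] at h2
    have h3 : (1 - x)⁻¹ - 1 ≤ x + x ^ 2 := by
      rw [sub_le_iff_le_add, inv_le_iff_one_le_mul₀ h1]
      nlinarith [mul_nonneg (neg_nonneg.2 h) (sq_nonneg x)]
    have h4 : 1 = Real.exp (-Real.log (1 - x)) * (1 - x) := by
      rw [Real.exp_neg, Real.exp_log h1, inv_mul_cancel₀ h1.ne']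
    calc (1 : ℝ) = Real.exp (-Real.log (1 - x)) * (1 - x) := h4
      _ ≤ _ := by gcongr; linarith

theorem integrable_exp_mul_sq_gaussianReal {v : NNReal} {θ : ℝ} (h : 2 * θ * v < 1) :
    Integrable (fun x => Real.exp (θ * x ^ 2)) (gaussianReal 0 v) := by
  rcases eq_or_ne v 0 with rfl | hv
  · rw [gaussianReal_zero_var]
    exact integrable_dirac (by simp)
  have hv' : (0 : ℝ) < v := by positivity
  have hb : 0 < (2 * (v : ℝ))⁻¹ - θ := by
    rw [sub_pos, ← one_div, lt_div_iff₀ (by positivity)]; linarith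
  rw [gaussianReal_of_var_ne_zero _ hv, integrable_withDensity_iff_integrable_smul'
    (measurable_gaussianPDF _ _) (by simp [gaussianPDF])]
  refine ((integrable_exp_neg_mul_sq hb).const_mul (√(2 * Real.pi * v))⁻¹).congr
    (.of_forall fun x => ?_)
  simp only [toReal_gaussianPDF, gaussianPDFReal, smul_eq_mul, mul_assoc, ← Real.exp_add]
  congr 2
  field_simp
  ring

theorem integral_exp_mul_sq_gaussianReal_le {v : NNReal} {θ : ℝ} (h : 2 * θ * v ≤ 1 / 2) :
    ∫ x, Real.exp (θ * x ^ 2) ∂(gaussianReal 0 v) ≤ Real.exp (θ * v + 2 * θ ^ 2 * v ^ 2) := by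
  rcases eq_or_ne v 0 with rfl | hv
  · simp
  have hv' : (0 : ℝ) < v := by positivity
  have hb : 0 < (2 * (v : ℝ))⁻¹ - θ := by
    rw [sub_pos, ← one_div, lt_div_iff₀ (by positivity)]; linarith
  have key : ∫ x, Real.exp (θ * x ^ 2) ∂(gaussianReal 0 v)
      = (√(2 * Real.pi * v))⁻¹ * √(Real.pi / ((2 * (v : ℝ))⁻¹ - θ)) := by
    rw [integral_gaussianReal_eq_integral_smul hv, ← integral_gaussian, ← integral_const_mul]
    refine integral_congr_ae (.of_forall fun x => ?_)
    simp only [gaussianPDFReal, smul_eq_mul, mul_assoc, ← Real.exp_add]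
    congr 2
    field_simp
    ring
  rw [key, ← Real.sqrt_inv, ← Real.sqrt_mul (by positivity)]
  refine Real.sqrt_le_iff.2 ⟨by positivity, ?_⟩
  have hx : 0 < 1 - 2 * θ * v := by linarith
  have e1 : (2 * Real.pi * v)⁻¹ * (Real.pi / ((2 * (v : ℝ))⁻¹ - θ)) = (1 - 2 * θ * v)⁻¹ := by
    have : (2 * (v : ℝ))⁻¹ - θ = (1 - 2 * θ * v) / (2 * v) := by field_simp
    rw [this]
    field_simp
  rw [e1, inv_le_iff_one_le_mul₀ hx, ← Real.exp_nat_mul]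
  have e2 : ((2 : ℕ) : ℝ) * (θ * v + 2 * θ ^ 2 * v ^ 2) = 2 * θ * v + (2 * θ * v) ^ 2 := by
    push_cast; ring
  rw [e2]
  exact one_le_exp_mul_one_sub h

theorem hasGaussianLaw_of_linear_combinations {Ω ι : Type*} [MeasurableSpace Ω] [Fintype ι]
    {P : Measure Ω} {Y : ι → Ω → ℝ} (hm : ∀ i, Measurable (Y i))
    (hY : ∀ a : ι → ℝ, ∃ v : NNReal, P.map (fun ω => ∑ i, a i * Y i ω) = gaussianReal 0 v) :
    HasGaussianLaw (fun ω => (Y · ω)) P := by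
  classical
  refine ⟨isGaussian_of_map_eq_gaussianReal fun L => ?_⟩
  obtain ⟨v, hv⟩ := hY fun i => L (Pi.single i 1)
  refine ⟨0, v, ?_⟩
  rw [← hv, Measure.map_map (by fun_prop) (by fun_prop)]
  congr 1
  ext ω
  simp only [Function.comp_apply]
  rw [← ContinuousLinearMap.coe_coe, LinearMap.pi_apply_eq_sum_univ]
  refine Finset.sum_congr rfl fun i _ => ?_
  simp only [smul_eq_mul, ContinuousLinearMap.coe_coe, mul_comm]
  congr 2
  ext j; simp [Pi.single_apply, eq_comm]

section SumSq

variable {Ω ι : Type*} [MeasurableSpace Ω] {P : Measure Ω}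

theorem integral_sq_of_map_eq_gaussianReal {V : Ω → ℝ} {v : NNReal} (hm : Measurable V)
    (hV : P.map V = gaussianReal 0 v) : ∫ ω, V ω ^ 2 ∂P = v := by
  have h : ∫ x, x ^ 2 ∂(gaussianReal 0 v) = v := by
    have := variance_fun_id_gaussianReal (μ := 0) (v := v)
    rw [variance_eq_integral measurable_id'.aemeasurable] at this
    simpa using this
  rw [← h, ← hV, integral_map hm.aemeasurable (by fun_prop)]

theorem memLp_two_of_map_eq_gaussianReal {V : Ω → ℝ} {v : NNReal} (hm : Measurable V)
    (hV : P.map V = gaussianReal 0 v) : MemLp V 2 P := by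
  have h := memLp_id_gaussianReal' (μ := 0) (v := v) 2 (by simp)
  rw [← hV] at h
  exact (memLp_map_measure_iff (by fun_prop) hm.aemeasurable).1 h

theorem integral_eq_zero_of_map_eq_gaussianReal {V : Ω → ℝ} {v : NNReal} (hm : Measurable V)
    (hV : P.map V = gaussianReal 0 v) : ∫ ω, V ω ∂P = 0 := by
  have h := integral_id_gaussianReal (μ := 0) (v := v)
  rwa [← hV, integral_map hm.aemeasurable (by fun_prop)] at h

theorem integrable_exp_mul_sq {V : Ω → ℝ} {v : NNReal} {θ : ℝ} (hm : Measurable V)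
    (hV : P.map V = gaussianReal 0 v) (h : 2 * θ * v < 1) :
    Integrable (fun ω => Real.exp (θ * V ω ^ 2)) P := by
  have h := integrable_exp_mul_sq_gaussianReal h
  rw [← hV, integrable_map_measure (by fun_prop) hm.aemeasurable] at h
  exact h

theorem mgf_sq_le {V : Ω → ℝ} {v : NNReal} {θ : ℝ} (hm : Measurable V)
    (hV : P.map V = gaussianReal 0 v) (h : 2 * θ * v ≤ 1 / 2) :
    mgf (fun ω => V ω ^ 2) P θ ≤ Real.exp (θ * v + 2 * θ ^ 2 * v ^ 2) := by
  have h := integral_exp_mul_sq_gaussianReal_le h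
  rwa [← hV, integral_map hm.aemeasurable (by fun_prop)] at h

variable [IsProbabilityMeasure P] [Fintype ι] {V : ι → Ω → ℝ} {v : ι → NNReal} {Λ : ℝ}

theorem mgf_sum_sq_le (hm : ∀ i, Measurable (V i)) (hind : iIndepFun V P)
    (hV : ∀ i, P.map (V i) = gaussianReal 0 (v i)) (hv : ∀ i, (v i : ℝ) ≤ Λ)
    {θ : ℝ} (hθ : θ * Λ ≤ 1 / 4) :
    Integrable (fun ω => Real.exp (θ * ∑ i, V i ω ^ 2)) P ∧
      mgf (fun ω => ∑ i, V i ω ^ 2) P θ ≤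
        Real.exp (θ * ∑ i, (v i : ℝ) + 2 * θ ^ 2 * Λ * ∑ i, (v i : ℝ)) := by
  have hi : ∀ i, 2 * θ * v i ≤ 1 / 2 := fun i => by
    rcases le_total 0 θ with h | h
    · nlinarith [mul_le_mul_of_nonneg_left (hv i) h]
    · nlinarith [mul_nonneg (neg_nonneg.2 h) (v i).2, NNReal.coe_nonneg (v i)]
  have hind2 : iIndepFun (fun i ω => V i ω ^ 2) P :=
    hind.comp (fun _ x => x ^ 2) fun _ => by fun_prop
  have hm2 : ∀ i, Measurable fun ω => V i ω ^ 2 := fun i => (hm i).pow_const 2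
  have hs : (fun ω => ∑ i, V i ω ^ 2) = ∑ i, fun ω => V i ω ^ 2 := by
    ext ω; simp
  constructor
  · have := hind2.integrable_exp_mul_sum (t := θ) hm2 (s := Finset.univ)
      fun i _ => integrable_exp_mul_sq (hm i) (hV i) ((hi i).trans_lt (by norm_num))
    simpa using this
  · rw [hs, hind2.mgf_sum hm2]
    calc ∏ i, mgf (fun ω => V i ω ^ 2) P θ
        ≤ ∏ i, Real.exp (θ * v i + 2 * θ ^ 2 * v i ^ 2) :=
          Finset.prod_le_prod (fun _ _ => mgf_nonneg) fun i _ => mgf_sq_le (hm i) (hV i) (hi i)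
      _ = Real.exp (∑ i, (θ * v i + 2 * θ ^ 2 * v i ^ 2)) := (Real.exp_sum _ _).symm
      _ ≤ _ := by
        rw [Real.exp_le_exp, Finset.mul_sum, Finset.mul_sum, ← Finset.sum_add_distrib]
        refine Finset.sum_le_sum fun i _ => ?_
        have := mul_le_mul_of_nonneg_right (hv i) (v i).2
        have := mul_le_mul_of_nonneg_left this (by positivity : 0 ≤ 2 * θ ^ 2)
        simp only [NNReal.val_eq_coe] at this
        linarith

theorem measureReal_abs_sqrt_sum_sq_sub_le_of_iIndepFun (hm : ∀ i, Measurable (V i))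
    (hind : iIndepFun V P) (hV : ∀ i, P.map (V i) = gaussianReal 0 (v i))
    (hv : ∀ i, (v i : ℝ) ≤ Λ) (hΛ : 0 < Λ) {h : ℝ} (hh : 0 < h) :
    P.real {ω | h ≤ |√(∑ i, V i ω ^ 2) - √(∑ i, (v i : ℝ))|} ≤
      2 * Real.exp (-(h ^ 2 / (8 * Λ))) := by
  set S : Ω → ℝ := fun ω => ∑ i, V i ω ^ 2
  set I := √(∑ i, (v i : ℝ))
  have hI0 : 0 ≤ I := Real.sqrt_nonneg _
  have hII : ∑ i, (v i : ℝ) = I ^ 2 :=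
    (Real.sq_sqrt (Finset.sum_nonneg fun i _ => (v i).2)).symm
  have hS0 : ∀ ω, 0 ≤ S ω := fun ω => Finset.sum_nonneg fun i _ => sq_nonneg _
  have upper : P.real {ω | (I + h) ^ 2 ≤ S ω} ≤ Real.exp (-(h ^ 2 / (8 * Λ))) := by
    have hθ0 : 0 ≤ h / (4 * Λ * (I + h)) := by positivity
    obtain ⟨h1, h2⟩ := mgf_sum_sq_le hm hind hV hv (θ := h / (4 * Λ * (I + h))) (by
      rw [div_mul_eq_mul_div, div_le_div_iff₀ (by positivity) (by norm_num)]
      nlinarith [mul_nonneg hΛ.le hI0])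
    refine (measure_ge_le_exp_mul_mgf _ hθ0 h1).trans ?_
    refine (mul_le_mul_of_nonneg_left h2 (Real.exp_nonneg _)).trans ?_
    rw [← Real.exp_add, Real.exp_le_exp, hII]
    have : h ^ 2 / (8 * Λ) + (-(h / (4 * Λ * (I + h))) * (I + h) ^ 2 +
        (h / (4 * Λ * (I + h)) * I ^ 2 + 2 * (h / (4 * Λ * (I + h))) ^ 2 * Λ * I ^ 2)) =
        -(h ^ 2 * (2 * I ^ 2 + 4 * I * h + h ^ 2) / (8 * Λ * (I + h) ^ 2)) := by
      field_simp
      ring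
    have : 0 ≤ h ^ 2 * (2 * I ^ 2 + 4 * I * h + h ^ 2) / (8 * Λ * (I + h) ^ 2) := by positivity
    linarith
  have lower : h ≤ I → P.real {ω | S ω ≤ (I - h) ^ 2} ≤ Real.exp (-(h ^ 2 / (8 * Λ))) := by
    intro hle
    have hIp : 0 < I := hh.trans_le hle
    have hθ0 : -(h / (4 * Λ * I)) ≤ 0 := neg_nonpos.2 (by positivity)
    obtain ⟨h1, h2⟩ := mgf_sum_sq_le hm hind hV hv (θ := -(h / (4 * Λ * I))) (by
      nlinarith)
    refine (measure_le_le_exp_mul_mgf _ hθ0 h1).trans ?_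
    refine (mul_le_mul_of_nonneg_left h2 (Real.exp_nonneg _)).trans ?_
    rw [← Real.exp_add, Real.exp_le_exp, hII]
    have : h ^ 2 / (8 * Λ) + (-(-(h / (4 * Λ * I))) * (I - h) ^ 2 +
        (-(h / (4 * Λ * I)) * I ^ 2 + 2 * (-(h / (4 * Λ * I))) ^ 2 * Λ * I ^ 2)) =
        -(h ^ 2 * (I - h) / (4 * Λ * I)) := by
      field_simp
      ring
    have : 0 ≤ h ^ 2 * (I - h) / (4 * Λ * I) := by
      have := sub_nonneg.2 hle
      positivity
    linarith
  have hsub : {ω | h ≤ |√(S ω) - I|} ⊆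
      {ω | (I + h) ^ 2 ≤ S ω} ∪ {ω | h ≤ I ∧ S ω ≤ (I - h) ^ 2} := by
    intro ω hω
    rcases le_abs.1 (Set.mem_ofPred.1 hω) with h1 | h1
    · left
      exact (Real.le_sqrt (by positivity) (hS0 ω)).1 (by linarith)
    · right
      have hle : h ≤ I := by linarith [Real.sqrt_nonneg (S ω)]
      exact ⟨hle, (Real.sqrt_le_left (sub_nonneg.2 hle)).1 (by linarith)⟩
  refine (measureReal_mono hsub).trans ((measureReal_union_le _ _).trans ?_)
  rw [two_mul]
  refine add_le_add upper ?_
  by_cases hle : h ≤ I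
  · simpa [hle] using lower hle
  · simpa [hle] using Real.exp_nonneg _

/-- The norm of a centered Gaussian vector concentrates around the root of its second moment at
the scale of the largest absolute row sum of the covariance matrix. -/
theorem measureReal_abs_sqrt_sum_sq_sub_le {Y : ι → Ω → ℝ} (hm : ∀ i, Measurable (Y i))
    (hY : ∀ a : ι → ℝ, ∃ v : NNReal, P.map (fun ω => ∑ i, a i * Y i ω) = gaussianReal 0 v)
    (hrow : ∀ i, ∑ j, |∫ ω, Y i ω * Y j ω ∂P| ≤ Λ) (hΛ : 0 < Λ) {h : ℝ} (hh : 0 < h) :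
    P.real {ω | h ≤ |√(∑ i, Y i ω ^ 2) - √(∑ i, ∫ ω, Y i ω ^ 2 ∂P)|} ≤
      2 * Real.exp (-(h ^ 2 / (8 * Λ))) := by
  classical
  let A : Matrix ι ι ℝ := .of fun i j => ∫ ω, Y i ω * Y j ω ∂P
  have hA : A.IsHermitian := by
    ext i j
    simp [A, mul_comm]
  let u := hA.eigenvectorBasis
  let V : ι → Ω → ℝ := fun i ω => ∑ k, u i k * Y k ω
  have hYL : ∀ i, MemLp (Y i) 2 P := fun i => by
    obtain ⟨v, hv⟩ := hY (Pi.single i 1)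
    refine memLp_two_of_map_eq_gaussianReal (v := v) (hm i) ?_
    rw [← hv]
    congr 1
    ext ω
    simp [Pi.single_apply]
  have hYi : ∀ i j, Integrable (fun ω => Y i ω * Y j ω) P := fun i j =>
    (hYL i).integrable_mul (hYL j)
  have hVm : ∀ i, Measurable (V i) := fun i => by fun_prop
  choose v hv using fun i => hY (u i)
  have hVV : ∀ i j, ∫ ω, V i ω * V j ω ∂P = hA.eigenvalues j * if i = j then 1 else 0 := by
    intro i j
    have h1 : ∀ ω, V i ω * V j ω = ∑ k, ∑ l, u i k * u j l * (Y k ω * Y l ω) := fun ω => by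
      simp only [V, Finset.sum_mul_sum]
      exact Finset.sum_congr rfl fun k _ => Finset.sum_congr rfl fun l _ => by ring
    simp_rw [h1]
    rw [integral_finsetSum _ fun k _ => integrable_finsetSum _ fun l _ => (hYi k l).const_mul _]
    have h2 : ∀ k, ∫ ω, ∑ l, u i k * u j l * (Y k ω * Y l ω) ∂P
        = u i k * (hA.eigenvalues j * u j k) := fun k => by
      rw [integral_finsetSum _ fun l _ => (hYi k l).const_mul _]
      have h3 := congrFun (hA.mulVec_eigenvectorBasis j) k
      simp only [Matrix.mulVec, dotProduct, Pi.smul_apply, smul_eq_mul] at h3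
      rw [← h3, Finset.mul_sum]
      refine Finset.sum_congr rfl fun l _ => ?_
      rw [integral_const_mul]
      simp only [A, u, Matrix.of_apply]
      ring
    simp_rw [h2]
    rw [← orthonormal_iff_ite.1 u.orthonormal i j, PiLp.inner_apply, Finset.mul_sum]
    refine Finset.sum_congr rfl fun k _ => ?_
    simp
    ring
  have hveq : ∀ i, (v i : ℝ) = hA.eigenvalues i := fun i => by
    rw [← integral_sq_of_map_eq_gaussianReal (hVm i) (hv i)]
    simpa [sq] using hVV i i
  have hvle : ∀ i, (v i : ℝ) ≤ Λ := fun i => by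
    have hev : Module.End.HasEigenvalue (Matrix.toLin' A) (hA.eigenvalues i) := by
      refine Module.End.hasEigenvalue_of_hasEigenvector (x := (u i : ι → ℝ)) ?_
      refine ⟨Module.End.mem_eigenspace_iff.2 ?_, ?_⟩
      · rw [Matrix.toLin'_apply]
        exact hA.mulVec_eigenvectorBasis i
      · intro h0
        refine u.orthonormal.ne_zero i ?_
        ext k
        exact congrFun h0 k
    obtain ⟨k, hk⟩ := eigenvalue_mem_ball hev
    rw [Metric.mem_closedBall, Real.dist_eq] at hk
    rw [hveq]
    have h1 := Finset.add_sum_erase Finset.univ (fun j => |A k j|) (Finset.mem_univ k)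
    simp only [Real.norm_eq_abs] at hk
    have h2 := hrow k
    change ∑ j, |A k j| ≤ Λ at h2
    linarith [le_abs_self (hA.eigenvalues i - A k k), le_abs_self (A k k)]
  have hgauss : HasGaussianLaw (fun ω => (V · ω)) P :=
    hasGaussianLaw_of_linear_combinations hVm fun a => by
      obtain ⟨w, hw⟩ := hY fun k => ∑ i, a i * u i k
      refine ⟨w, hw ▸ ?_⟩
      congr 1
      ext ω
      simp only [V, Finset.mul_sum, Finset.sum_mul]
      rw [Finset.sum_comm]
      exact Finset.sum_congr rfl fun k _ => Finset.sum_congr rfl fun l _ => by ring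
  have hVL : ∀ i, MemLp (V i) 2 P := fun i => memLp_two_of_map_eq_gaussianReal (hVm i) (hv i)
  have hind : iIndepFun V P := hgauss.iIndepFun_of_covariance_eq_zero fun i j hij => by
    rw [covariance_eq_sub (hVL i) (hVL j), integral_eq_zero_of_map_eq_gaussianReal (hVm i) (hv i),
      zero_mul, sub_zero]
    simpa [hij] using hVV i j
  have hsum : ∀ ω, ∑ i, V i ω ^ 2 = ∑ i, Y i ω ^ 2 := fun ω => by
    have h1 := u.sum_sq_norm_inner_right (WithLp.toLp 2 fun k => Y k ω)
    rw [EuclideanSpace.norm_sq_eq] at h1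
    simpa [V, PiLp.inner_apply, mul_comm] using h1
  have hsumv : ∑ i, (v i : ℝ) = ∑ i, ∫ ω, Y i ω ^ 2 ∂P := by
    rw [← integral_finsetSum _ fun i _ => (hYL i).integrable_sq]
    simp_rw [← hsum]
    rw [integral_finsetSum _ fun i _ => (hVL i).integrable_sq]
    exact Finset.sum_congr rfl fun i _ => (integral_sq_of_map_eq_gaussianReal (hVm i) (hv i)).symm
  have := measureReal_abs_sqrt_sum_sq_sub_le_of_iIndepFun hVm hind hv hvle hΛ hh
  simpa only [hsum, hsumv] using this

end SumSq

/-- Mean value theorem for the rectangular increment of a function of two variables. -/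
theorem exists_rectangular_increment_eq {F F₂ F₁₂ : ℝ → ℝ → ℝ} {a b δ : ℝ} (hδ : 0 < δ)
    (h₂ : ∀ s ∈ Set.Icc a (a + δ), ∀ t ∈ Set.Icc b (b + δ), HasDerivAt (F s) (F₂ s t) t)
    (h₁₂ : ∀ s ∈ Set.Icc a (a + δ), ∀ t ∈ Set.Icc b (b + δ),
      HasDerivAt (fun u => F₂ u t) (F₁₂ s t) s) :
    ∃ s ∈ Set.Icc a (a + δ), ∃ t ∈ Set.Icc b (b + δ),
      F (a + δ) (b + δ) - F (a + δ) b - F a (b + δ) + F a b = δ ^ 2 * F₁₂ s t := by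
  have ha : a ∈ Set.Icc a (a + δ) := ⟨le_rfl, by linarith⟩
  have ha' : a + δ ∈ Set.Icc a (a + δ) := ⟨by linarith, le_rfl⟩
  have hd : ∀ t ∈ Set.Icc b (b + δ),
      HasDerivAt (fun t => F (a + δ) t - F a t) (F₂ (a + δ) t - F₂ a t) t := fun t ht =>
    (h₂ _ ha' t ht).sub (h₂ _ ha t ht)
  obtain ⟨t, ht, het⟩ := exists_hasDerivAt_eq_slope _ _ (by linarith : b < b + δ)
    (fun t ht => (hd t ht).continuousAt.continuousWithinAt)
    (fun t ht => hd t (Set.Ioo_subset_Icc_self ht))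
  have ht' := Set.Ioo_subset_Icc_self ht
  obtain ⟨s, hs, hes⟩ := exists_hasDerivAt_eq_slope (fun u => F₂ u t) (fun s => F₁₂ s t)
    (by linarith : a < a + δ)
    (fun s hs => (h₁₂ s hs t ht').continuousAt.continuousWithinAt)
    (fun s hs => h₁₂ s (Set.Ioo_subset_Icc_self hs) t ht')
  refine ⟨s, Set.Ioo_subset_Icc_self hs, t, ht', ?_⟩
  rw [add_sub_cancel_left, eq_div_iff hδ.ne'] at het hes
  linear_combination -het - δ * hes

/-- A summable envelope for the covariances of increments at unit scale and lag `n`. -/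
noncomputable def covEnvelope (H c C : ℝ) (n : ℤ) : ℝ :=
  if n.natAbs ≤ 1 then C else c / 2 * ((n.natAbs : ℝ) - 1) ^ (2 * H - 2)

theorem covEnvelope_nonneg {H c C : ℝ} (hc : 0 < c) (hC : 0 < C) (n : ℤ) :
    0 ≤ covEnvelope H c C n := by
  unfold covEnvelope
  split_ifs with h
  · exact hC.le
  · have : (1 : ℝ) ≤ n.natAbs := by exact_mod_cast (not_le.1 h).le
    have := sub_nonneg.2 this
    positivity

theorem summable_covEnvelope {H c C : ℝ} (hH : H < 1 / 2) : Summable (covEnvelope H c C) := by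
  have h : Summable fun n : ℕ => covEnvelope H c C n := by
    rw [← summable_nat_add_iff 2]
    have h1 : Summable fun n : ℕ => c / 2 * ((n + 1 : ℕ) : ℝ) ^ (2 * H - 2) :=
      ((summable_nat_add_iff 1).2 (Real.summable_nat_rpow.2 (by linarith))).mul_left _
    refine h1.congr fun n => ?_
    have : ¬ ((n + 2 : ℕ) : ℤ).natAbs ≤ 1 := by omega
    rw [covEnvelope, if_neg this, Int.natAbs_natCast]
    congr 2
    push_cast
    ring
  refine Summable.of_nat_of_neg h (h.congr fun n => ?_)
  simp [covEnvelope]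

theorem sum_covEnvelope_le {H c C : ℝ} (hH : H < 1 / 2) (hc : 0 < c) (hC : 0 < C) (s : Finset ℕ)
    (i : ℕ) : ∑ j ∈ s, covEnvelope H c C ((i : ℤ) - j) ≤ ∑' n, covEnvelope H c C n := by
  have hinj : Function.Injective fun j : ℕ => (i : ℤ) - j := fun j k h => by
    simp only at h
    omega
  have h := (summable_covEnvelope hH).sum_le_tsum (s.map ⟨_, hinj⟩)
    fun n _ => covEnvelope_nonneg hc hC n
  rwa [Finset.sum_map] at h

namespace IsClassX

variable {H β c C T : ℝ} {Ω : Type*} [MeasurableSpace Ω] {P : Measure Ω} {X : Ω → ℝ → ℝ}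

theorem exists_map_sum_eq_gaussianReal (hX : IsClassX H β c C T P X) {κ : Type*} [Fintype κ]
    (t a : κ → ℝ) (ht : ∀ i, t i ∈ Set.Icc 0 T) :
    ∃ v : NNReal, P.map (fun ω => ∑ i, a i * X ω (t i)) = gaussianReal 0 v := by
  let e := (Fintype.equivFin κ).symm
  obtain ⟨v, hv⟩ := hX.2.2.1 _ (t ∘ e) (a ∘ e) fun i => ht _
  refine ⟨v, hv ▸ ?_⟩
  congr 1
  ext ω
  exact (e.sum_comp fun i => a i * X ω (t i)).symm

theorem exists_map_sum_increments_eq_gaussianReal (hX : IsClassX H β c C T P X) {κ : Type*}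
    [Fintype κ] (s t a : κ → ℝ) (hs : ∀ i, s i ∈ Set.Icc 0 T) (ht : ∀ i, t i ∈ Set.Icc 0 T) :
    ∃ v : NNReal,
      P.map (fun ω => ∑ i, a i * (X ω (t i) - X ω (s i))) = gaussianReal 0 v := by
  obtain ⟨v, hv⟩ := hX.exists_map_sum_eq_gaussianReal (Sum.elim t s) (Sum.elim a fun i => -a i)
    (by rintro (i | i) <;> simp [hs, ht, - Set.mem_Icc])
  refine ⟨v, hv ▸ ?_⟩
  congr 1
  ext ω
  simp only [Fintype.sum_sum_type, Sum.elim_inl, Sum.elim_inr, sub_eq_add_neg, mul_add,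
    mul_neg, neg_mul, Finset.sum_add_distrib]

theorem memLp_increment (hX : IsClassX H β c C T P X) {s t : ℝ} (hs : s ∈ Set.Icc 0 T)
    (ht : t ∈ Set.Icc 0 T) : MemLp (fun ω => X ω t - X ω s) 2 P := by
  obtain ⟨v, hv⟩ := hX.exists_map_sum_increments_eq_gaussianReal (κ := Unit) (fun _ => s)
    (fun _ => t) (fun _ => 1) (fun _ => hs) (fun _ => ht)
  exact memLp_two_of_map_eq_gaussianReal (v := v) ((hX.1 t).sub (hX.1 s)) (by simpa using hv)

theorem abs_integral_mul_increments_le (hX : IsClassX H β c C T P X) {a b δ : ℝ} (hδ : 0 < δ)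
    (ha : 0 ≤ a) (ha' : a + δ ≤ T) (hb : 0 ≤ b) (hb' : b + δ ≤ T) :
    |∫ ω, (X ω (a + δ) - X ω a) * (X ω (b + δ) - X ω b) ∂P| ≤ C * δ ^ (2 * H) := by
  have hA := hX.memLp_increment (s := a) (t := a + δ) ⟨ha, by linarith⟩ ⟨by linarith, ha'⟩
  have hB := hX.memLp_increment (s := b) (t := b + δ) ⟨hb, by linarith⟩ ⟨by linarith, hb'⟩
  have h1 := (hX.2.2.2.2 a (a + δ) ⟨ha, by linarith⟩ ⟨by linarith, ha'⟩).2
  have h2 := (hX.2.2.2.2 b (b + δ) ⟨hb, by linarith⟩ ⟨by linarith, hb'⟩).2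
  rw [add_sub_cancel_left, abs_of_pos hδ] at h1 h2
  have h3 : ∫ ω, |(X ω (a + δ) - X ω a) * (X ω (b + δ) - X ω b)| ∂P ≤
      ∫ ω, ((X ω (a + δ) - X ω a) ^ 2 + (X ω (b + δ) - X ω b) ^ 2) / 2 ∂P := by
    refine integral_mono (hA.integrable_mul hB).abs
      ((hA.integrable_sq.add hB.integrable_sq).div_const 2) fun ω => ?_
    simp only [abs_mul]
    nlinarith [sq_nonneg (|X ω (a + δ) - X ω a| - |X ω (b + δ) - X ω b|),
      sq_abs (X ω (a + δ) - X ω a), sq_abs (X ω (b + δ) - X ω b)]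
  rw [integral_div, integral_add hA.integrable_sq hB.integrable_sq] at h3
  linarith [abs_integral_le_integral_abs (μ := P)
    (f := fun ω => (X ω (a + δ) - X ω a) * (X ω (b + δ) - X ω b))]

theorem integral_mul_increments (hX : IsClassX H β c C T P X) {a a' b b' : ℝ}
    (ha : a ∈ Set.Icc 0 T) (ha' : a' ∈ Set.Icc 0 T) (hb : b ∈ Set.Icc 0 T)
    (hb' : b' ∈ Set.Icc 0 T) :
    ∫ ω, (X ω a' - X ω a) * (X ω b' - X ω b) ∂P =
      -((∫ ω, (X ω b' - X ω a') ^ 2 ∂P) - (∫ ω, (X ω b - X ω a') ^ 2 ∂P) -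
        (∫ ω, (X ω b' - X ω a) ^ 2 ∂P) + ∫ ω, (X ω b - X ω a) ^ 2 ∂P) / 2 := by
  have i1 := (hX.memLp_increment ha' hb').integrable_sq
  have i2 := (hX.memLp_increment ha' hb).integrable_sq
  have i3 := (hX.memLp_increment ha hb').integrable_sq
  have i4 := (hX.memLp_increment ha hb).integrable_sq
  have i12 : Integrable (fun ω => (X ω b' - X ω a') ^ 2 - (X ω b - X ω a') ^ 2) P := i1.sub i2
  have i123 : Integrable
      (fun ω => (X ω b' - X ω a') ^ 2 - (X ω b - X ω a') ^ 2 - (X ω b' - X ω a) ^ 2) P := i12.sub i3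
  rw [← integral_sub i1 i2, ← integral_sub i12 i3, ← integral_add i123 i4,
    ← integral_neg, ← integral_div]
  congr 1
  ext ω
  ring

theorem abs_integral_mul_increments_le_of_gap (hX : IsClassX H β c C T P X) (hc : 0 < c)
    (hH : H < 1) {a b δ m : ℝ} (hδ : 0 < δ) (hm : 0 < m)
    (ha : 0 ≤ a) (ha' : a + δ ≤ T) (hb : 0 ≤ b) (hb' : b + δ ≤ T)
    (hgap : (m + 1) * δ ≤ |a - b|) :
    |∫ ω, (X ω (a + δ) - X ω a) * (X ω (b + δ) - X ω b) ∂P| ≤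
      c / 2 * m ^ (2 * H - 2) * δ ^ (2 * H) := by
  obtain ⟨F₂, F₁₂, h₂, h₁₂, hbd⟩ := hX.2.2.2.1
  have hdist : ∀ s ∈ Set.Icc a (a + δ), ∀ t ∈ Set.Icc b (b + δ), m * δ ≤ |t - s| := by
    rintro s ⟨hs, hs'⟩ t ⟨ht, ht'⟩
    rcases le_abs.1 hgap with h | h
    · exact le_abs.2 (Or.inr (by linarith))
    · exact le_abs.2 (Or.inl (by linarith))
  have hmδ : 0 < m * δ := by positivity
  have hne : ∀ s ∈ Set.Icc a (a + δ), ∀ t ∈ Set.Icc b (b + δ), s ≠ t := by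
    rintro s hs t ht rfl
    have := hdist s hs s ht
    simp only [sub_self, abs_zero] at this
    linarith
  have hIa : Set.Icc a (a + δ) ⊆ Set.Icc 0 T := Set.Icc_subset_Icc ha ha'
  have hIb : Set.Icc b (b + δ) ⊆ Set.Icc 0 T := Set.Icc_subset_Icc hb hb'
  obtain ⟨s, hs, t, ht, h⟩ := exists_rectangular_increment_eq
    (F := fun s u => ∫ ω, (X ω u - X ω s) ^ 2 ∂P) (a := a) (b := b) hδ
    (fun s hs t ht => h₂ s t (hIa hs) (hIb ht) (hne s hs t ht))
    (fun s hs t ht => h₁₂ s t (hIa hs) (hIb ht) (hne s hs t ht))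
  rw [hX.integral_mul_increments ⟨ha, by linarith⟩ ⟨by linarith, ha'⟩ ⟨hb, by linarith⟩
    ⟨by linarith, hb'⟩, h, abs_div, abs_neg, abs_mul, abs_of_pos (by positivity : 0 < δ ^ 2),
    abs_of_pos (two_pos : (0 : ℝ) < 2)]
  have h1 := hbd s t (hIa hs) (hIb ht) (hne s hs t ht)
  have h2 : |t - s| ^ (2 * H - 2) ≤ (m * δ) ^ (2 * H - 2) :=
    Real.rpow_le_rpow_of_nonpos hmδ (hdist s hs t ht) (by linarith)
  rw [Real.mul_rpow hm.le hδ.le] at h2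
  have h3 : δ ^ (2 * H) = δ ^ 2 * δ ^ (2 * H - 2) := by
    rw [← Real.rpow_natCast, ← Real.rpow_add hδ]
    congr 1
    push_cast
    ring
  rw [h3, div_le_iff₀ two_pos]
  have h4 := mul_le_mul_of_nonneg_left (h1.trans (mul_le_mul_of_nonneg_left h2 hc.le))
    (sq_nonneg δ)
  linarith

theorem abs_integral_mul_grid_increments_le (hX : IsClassX H β c C T P X) (hc : 0 < c)
    (hH : H < 1) {δ : ℝ} (hδ : 0 < δ) {N : ℕ} (hN : δ * N < T) {i j : ℕ}
    (hi : i ∈ Finset.Icc 1 N) (hj : j ∈ Finset.Icc 1 N) :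
    |∫ ω, (X ω (i * δ) - X ω ((i - 1 : ℝ) * δ)) * (X ω (j * δ) - X ω ((j - 1 : ℝ) * δ)) ∂P| ≤
      covEnvelope H c C ((i : ℤ) - j) * δ ^ (2 * H) := by
  have hgrid : ∀ k ∈ Finset.Icc 1 N, 0 ≤ ((k : ℝ) - 1) * δ ∧ ((k : ℝ) - 1) * δ + δ ≤ T := by
    intro k hk
    obtain ⟨h1, h2⟩ := Finset.mem_Icc.1 hk
    have h1' : (1 : ℝ) ≤ k := by exact_mod_cast h1
    have h2' : (k : ℝ) ≤ N := by exact_mod_cast h2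
    exact ⟨mul_nonneg (by linarith) hδ.le, by nlinarith⟩
  have hsucc : ∀ k : ℕ, (k : ℝ) * δ = ((k : ℝ) - 1) * δ + δ := fun k => by ring
  obtain ⟨hi1, hi2⟩ := hgrid i hi
  obtain ⟨hj1, hj2⟩ := hgrid j hj
  rw [hsucc i, hsucc j, covEnvelope]
  split_ifs with hij
  · exact hX.abs_integral_mul_increments_le hδ hi1 hi2 hj1 hj2
  · have h1 : (1 : ℝ) < ((i : ℤ) - j).natAbs := by exact_mod_cast not_le.1 hij
    refine hX.abs_integral_mul_increments_le_of_gap hc hH hδ (sub_pos.2 h1) hi1 hi2 hj1 hj2 ?_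
    have h2 : ((i : ℝ) - 1) * δ - ((j : ℝ) - 1) * δ = ((i : ℝ) - j) * δ := by ring
    rw [h2, abs_mul, abs_of_pos hδ, sub_add_cancel, Nat.cast_natAbs]
    push_cast
    exact le_rfl

end IsClassX

/-- **Concentration for increments of processes in `𝒳^{(H,β)}`, case
`H < 1/2` (Theorem 8(2)).**  With `Y_k = X_{kδ} − X_{(k−1)δ}` and
`I² = Σ_k E[Y_k²]`, there are constants `C₁, C₂ > 0` independent of `δ`, `N`
and `T` such that `P(|‖Y‖₂ − I| ≥ h) ≤ C₁·exp(−C₂·h²/δ^{2H})`. -/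
theorem concentration_classX_low_H
    (H β c C : ℝ) (hH : H ∈ Set.Ioo (0 : ℝ) (1/2)) (hβ : β ∈ Set.Ico H 1)
    (hc : 0 < c) (hC : 0 < C)
    {Ω : Type*} [MeasurableSpace Ω] (P : Measure Ω) [IsProbabilityMeasure P]
    (X : Ω → ℝ → ℝ) :
    ∃ C₁ C₂ : ℝ, 0 < C₁ ∧ 0 < C₂ ∧
      ∀ T : ℝ, 0 < T → IsClassX H β c C T P X →
      ∀ (N : ℕ) (δ : ℝ), 0 < δ → δ * N < T →
      ∀ h : ℝ, 0 < h →
        P {ω | |Real.sqrt (∑ k ∈ Finset.Icc 1 N,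
                  (X ω (k * δ) - X ω ((k - 1 : ℝ) * δ)) ^ 2) -
                Real.sqrt (∑ k ∈ Finset.Icc 1 N,
                  ∫ ω', (X ω' (k * δ) - X ω' ((k - 1 : ℝ) * δ)) ^ 2 ∂P)| ≥ h}
          ≤ ENNReal.ofReal
              (C₁ * Real.exp (-(C₂ * h ^ 2 / δ ^ (2 * H)))) := by
  set K := ∑' n, covEnvelope H c C n
  have hK0 : 0 ≤ K := tsum_nonneg fun n => covEnvelope_nonneg hc hC n
  refine ⟨2, 1 / (8 * (K + 1)), two_pos, by positivity, ?_⟩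
  intro T _ hX N δ hδ hN h hh
  have hδH : 0 < δ ^ (2 * H) := by positivity
  have hmem : ∀ k : Finset.Icc 1 N,
      ((k : ℕ) : ℝ) * δ ∈ Set.Icc 0 T ∧ (((k : ℕ) : ℝ) - 1) * δ ∈ Set.Icc 0 T := by
    rintro ⟨k, hk⟩
    obtain ⟨h1, h2⟩ := Finset.mem_Icc.1 hk
    have h1' : (1 : ℝ) ≤ k := by exact_mod_cast h1
    have h2' : (k : ℝ) ≤ N := by exact_mod_cast h2
    exact ⟨⟨by positivity, by nlinarith⟩, ⟨mul_nonneg (by linarith) hδ.le, by nlinarith⟩⟩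
  have hrow : ∀ i : Finset.Icc 1 N, ∑ j : Finset.Icc 1 N,
      |∫ ω, (X ω ((i : ℕ) * δ) - X ω (((i : ℕ) - 1 : ℝ) * δ)) *
        (X ω ((j : ℕ) * δ) - X ω (((j : ℕ) - 1 : ℝ) * δ)) ∂P| ≤ (K + 1) * δ ^ (2 * H) := by
    intro i
    calc _ ≤ ∑ j : Finset.Icc 1 N, covEnvelope H c C ((i : ℕ) - (j : ℕ)) * δ ^ (2 * H) :=
          Finset.sum_le_sum fun j _ =>
            hX.abs_integral_mul_grid_increments_le hc (by linarith [hH.2]) hδ hN i.2 j.2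
      _ = (∑ j ∈ Finset.Icc 1 N, covEnvelope H c C ((i : ℕ) - (j : ℕ))) * δ ^ (2 * H) := by
          rw [← Finset.sum_mul,
            Finset.sum_coe_sort (Finset.Icc 1 N) fun j => covEnvelope H c C ((i : ℕ) - (j : ℕ))]
      _ ≤ _ := by
          gcongr
          linarith [sum_covEnvelope_le hH.2 hc hC (Finset.Icc 1 N) i]
  have key := measureReal_abs_sqrt_sum_sq_sub_le (P := P)
    (Y := fun (k : Finset.Icc 1 N) ω => X ω ((k : ℕ) * δ) - X ω (((k : ℕ) - 1 : ℝ) * δ))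
    (fun k => (hX.1 _).sub (hX.1 _))
    (fun a => hX.exists_map_sum_increments_eq_gaussianReal _ _ a
      (fun k => (hmem k).2) (fun k => (hmem k).1))
    hrow (by positivity) hh
  simp only [Finset.sum_coe_sort (Finset.Icc 1 N)
      fun k => ∫ ω, (X ω ((k : ℕ) * δ) - X ω (((k : ℕ) - 1 : ℝ) * δ)) ^ 2 ∂P,
    fun ω => Finset.sum_coe_sort (Finset.Icc 1 N)
      fun k => (X ω ((k : ℕ) * δ) - X ω (((k : ℕ) - 1 : ℝ) * δ)) ^ 2] at key
  have hexp : 1 / (8 * (K + 1)) * h ^ 2 / δ ^ (2 * H) = h ^ 2 / (8 * ((K + 1) * δ ^ (2 * H))) := by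
    field_simp
  rw [hexp, ← ofReal_measureReal]
  exact ENNReal.ofReal_le_ofReal key
end

section
/- Let H ∈ (0, 1/2), let B^H = {B^H_t}_{t∈[0,T]} be a fractional Brownian motion with Hurst parameter H, and fix β ∈ (0, H). Then there exist constants C_1, C_2 > 0 (which may depend on H, β and T but not on ε) such that for every ε ∈ (0,1), P( ‖B^H‖_β ≤ ε ) ≤ C_1·exp( − C_2·ε^{−1/(H−β)} ), where ‖f‖_β = sup_{0 ≤ s < t ≤ T} |f(t) − f(s)|/(t−s)^β is the β-Hölder seminorm on [0,T]. -/
open MeasureTheory ProbabilityTheory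

/-- The `β`-Hölder seminorm of a path on `[0,T]`:
`‖f‖_β = sup_{0 ≤ s < t ≤ T} |f(t) − f(s)| / (t − s)^β`. -/
noncomputable def holderSemiNorm (T β : ℝ) (f : ℝ → ℝ) : ℝ :=
  sSup {r : ℝ | ∃ s t : ℝ, 0 ≤ s ∧ s < t ∧ t ≤ T ∧ r = |f t - f s| / (t - s) ^ β}

/-- `X` is a fractional Brownian motion with Hurst parameter `H` on `[0,∞)`:
a centered continuous Gaussian process with `X_0 = 0` and covariance
`E[X_s X_t] = (s^{2H} + t^{2H} − |t−s|^{2H})/2`. -/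
def IsFBM {Ω : Type*} [MeasurableSpace Ω] (P : Measure Ω) (H : ℝ)
    (X : Ω → ℝ → ℝ) : Prop :=
  (∀ t, Measurable fun ω => X ω t) ∧
  (∀ᵐ ω ∂P, X ω 0 = 0) ∧
  (∀ᵐ ω ∂P, ContinuousOn (X ω) (Set.Ici 0)) ∧
  (∀ (n : ℕ) (t coef : Fin n → ℝ), (∀ i, 0 ≤ t i) →
    ∃ v : NNReal,
      Measure.map (fun ω => ∑ i, coef i * X ω (t i)) P = gaussianReal 0 v) ∧
  (∀ s t : ℝ, 0 ≤ s → 0 ≤ t →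
    ∫ ω, X ω s * X ω t ∂P = (s ^ (2 * H) + t ^ (2 * H) - |t - s| ^ (2 * H)) / 2)

open Filter Topology
open scoped NNReal ENNReal

lemma integral_exp_neg_mul_sq_gaussianReal {a : ℝ} (ha : 0 ≤ a) :
    ∫ x, Real.exp (-(a * x ^ 2 / 2)) ∂gaussianReal 0 1 = (√(1 + a))⁻¹ := by
  rw [integral_gaussianReal_eq_integral_smul one_ne_zero]
  have h : ∀ x : ℝ, gaussianPDFReal 0 1 x • Real.exp (-(a * x ^ 2 / 2))
      = (√(2 * Real.pi))⁻¹ * Real.exp (-((1 + a) / 2) * x ^ 2) := by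
    intro x
    rw [gaussianPDFReal, smul_eq_mul, mul_assoc, ← Real.exp_add]
    simp only [NNReal.coe_one, mul_one]
    congr 2
    ring
  simp_rw [h]
  rw [integral_const_mul, integral_gaussian, ← Real.sqrt_inv, ← Real.sqrt_inv,
    ← Real.sqrt_mul (by positivity)]
  congr 1
  field_simp

lemma integral_cexp_mul_gaussianReal (y : ℝ) :
    ∫ x : ℝ, Complex.exp ((x * y : ℝ) * Complex.I) ∂gaussianReal 0 1
      = (Real.exp (-(y ^ 2 / 2)) : ℝ) := by
  have h := charFun_gaussianReal (μ := 0) (v := 1) y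
  rw [charFun_apply_real] at h
  convert! h using 1
  · refine integral_congr_ae (ae_of_all _ fun x => ?_)
    simp only
    push_cast
    ring_nf
  · push_cast
    simp

/-- Gaussian randomization: a family all of whose linear combinations are centered Gaussian with
variance at least `a` times the squared length of the coefficient vector has a Laplace transform
of its squared length dominated by that of independent variables of variance `a`. -/
lemma integral_exp_neg_sum_sq_le {Ω ι : Type*} [MeasurableSpace Ω] [Fintype ι]
    {P : Measure Ω} [IsProbabilityMeasure P] {D : ι → Ω → ℝ} (hD : ∀ i, Measurable (D i))
    {a : ℝ} (ha : 0 ≤ a)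
    (hlaw : ∀ u : ι → ℝ, ∃ v : ℝ≥0, P.map (fun ω => ∑ i, u i * D i ω) = gaussianReal 0 v ∧
      a * ∑ i, u i ^ 2 ≤ v) :
    ∫ ω, Real.exp (-(∑ i, D i ω ^ 2 / 2)) ∂P ≤ (√(1 + a))⁻¹ ^ Fintype.card ι := by
  set G : Measure (ι → ℝ) := Measure.pi fun _ => gaussianReal 0 1 with hG
  let F : Ω → (ι → ℝ) → ℂ := fun ω g => Complex.exp ((∑ i, g i * D i ω : ℝ) * Complex.I)
  have hF : Measurable (Function.uncurry F) := by
    have : ∀ i, Measurable fun p : Ω × (ι → ℝ) => D i p.1 := fun i => (hD i).comp measurable_fst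
    unfold F Function.uncurry
    fun_prop
  have hFint : Integrable (Function.uncurry F) (P.prod G) := by
    refine Integrable.of_bound hF.aestronglyMeasurable 1 (ae_of_all _ fun p => ?_)
    simp only [F, Function.uncurry]
    rw [Complex.norm_exp_ofReal_mul_I]
  have hswap := integral_integral_swap hFint
  have hleft : ∀ ω, ∫ g, F ω g ∂G = (Real.exp (-(∑ i, D i ω ^ 2 / 2)) : ℝ) := by
    intro ω
    have : ∀ g, F ω g = ∏ i, Complex.exp ((g i * D i ω : ℝ) * Complex.I) := by
      intro g
      rw [← Complex.exp_sum, ← Finset.sum_mul]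
      simp [F]
    simp_rw [this]
    rw [hG, integral_fintype_prod_eq_prod
      (f := fun i (x : ℝ) => Complex.exp ((x * D i ω : ℝ) * Complex.I))]
    simp_rw [integral_cexp_mul_gaussianReal]
    rw [← Complex.ofReal_prod, ← Real.exp_sum, Finset.sum_neg_distrib]
  have hright : ∀ g, ‖∫ ω, F ω g ∂P‖ ≤ ∏ i, Real.exp (-(a * g i ^ 2 / 2)) := by
    intro g
    obtain ⟨v, hv, hav⟩ := hlaw g
    have h1 : ∫ ω, F ω g ∂P = charFun (gaussianReal 0 v) 1 := by
      rw [← hv, charFun_apply_real, integral_map]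
      · simp [F]
      · exact (Finset.measurable_sum _ fun i _ => (hD i).const_mul _).aemeasurable
      · fun_prop
    rw [h1, charFun_gaussianReal, Complex.norm_exp, ← Real.exp_sum, Finset.sum_neg_distrib,
      ← Finset.sum_div, ← Finset.mul_sum]
    simp
    linarith
  simp_rw [hleft] at hswap
  rw [integral_complex_ofReal] at hswap
  have h2 : ‖∫ g, ∫ ω, F ω g ∂P ∂G‖ ≤ ∫ g, ∏ i, Real.exp (-(a * g i ^ 2 / 2)) ∂G := by
    refine norm_integral_le_of_norm_le ?_ (ae_of_all _ hright)
    refine Integrable.of_bound (Measurable.aestronglyMeasurable (by fun_prop)) 1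
      (ae_of_all _ fun g => ?_)
    rw [← Real.exp_sum, Real.norm_eq_abs, Real.abs_exp, Real.exp_le_one_iff,
      Finset.sum_neg_distrib, neg_nonpos]
    exact Finset.sum_nonneg fun i _ => by positivity
  rw [← hswap, hG, integral_fintype_prod_eq_pow (f := fun x : ℝ => Real.exp (-(a * x ^ 2 / 2))),
    integral_exp_neg_mul_sq_gaussianReal ha] at h2
  refine le_trans (le_trans (le_abs_self _) ?_) h2
  simp

/-- Exponential small-ball bound for Gaussian families with nondegenerate covariance. -/
lemma measure_forall_abs_le_le {Ω ι : Type*} [MeasurableSpace Ω] [Fintype ι]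
    {P : Measure Ω} [IsProbabilityMeasure P] {D : ι → Ω → ℝ} (hD : ∀ i, Measurable (D i))
    {a : ℝ} (ha : 0 ≤ a)
    (hlaw : ∀ u : ι → ℝ, ∃ v : ℝ≥0, P.map (fun ω => ∑ i, u i * D i ω) = gaussianReal 0 v ∧
      a * ∑ i, u i ^ 2 ≤ v) :
    P {ω | ∀ i, |D i ω| ≤ √(Real.log (1 + a) / 2)}
      ≤ ENNReal.ofReal (Real.exp (-(Fintype.card ι * (Real.log (1 + a) / 4)))) := by
  set l := Real.log (1 + a) with hl
  have hl0 : 0 ≤ l := Real.log_nonneg (by linarith)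
  set n : ℝ := (Fintype.card ι : ℝ) with hn
  set E : Ω → ℝ := fun ω => Real.exp (-(∑ i, D i ω ^ 2 / 2)) with hE
  have hEint : Integrable E P := by
    refine Integrable.of_bound (by fun_prop) 1 (ae_of_all _ fun ω => ?_)
    rw [hE, Real.norm_eq_abs, Real.abs_exp, Real.exp_le_one_iff, neg_nonpos]
    exact Finset.sum_nonneg fun i _ => by positivity
  have hmark := mul_meas_ge_le_integral_of_nonneg (μ := P) (f := E)
    (ae_of_all _ fun ω => (Real.exp_pos _).le) hEint (Real.exp (-(n * (l / 4))))
  have hpow : (√(1 + a))⁻¹ ^ Fintype.card ι = Real.exp (-(n * (l / 2))) := by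
    have h1 : (√(1 + a))⁻¹ = Real.exp (-(l / 2)) := by
      rw [Real.exp_neg, Real.sqrt_eq_rpow, Real.rpow_def_of_pos (by linarith)]
      congr 2
      rw [hl]; ring
    rw [h1, ← Real.exp_nat_mul, mul_neg]
  have hle := hmark.trans ((integral_exp_neg_sum_sq_le hD ha hlaw).trans_eq hpow)
  have hsub : {ω | ∀ i, |D i ω| ≤ √(l / 2)} ⊆ {ω | Real.exp (-(n * (l / 4))) ≤ E ω} := by
    intro ω hω
    simp only [hE, Set.mem_ofPred_eq, Real.exp_le_exp, neg_le_neg_iff] at hω ⊢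
    calc ∑ i, D i ω ^ 2 / 2 ≤ ∑ _i : ι, l / 4 := by
          refine Finset.sum_le_sum fun i _ => ?_
          have := (sq_le_sq₀ (abs_nonneg _) (Real.sqrt_nonneg _)).2 (hω i)
          rw [sq_abs, Real.sq_sqrt (by linarith)] at this
          linarith
      _ = n * (l / 4) := by simp [hn]
  refine (measure_mono hsub).trans ?_
  rw [← ofReal_measureReal]
  refine ENNReal.ofReal_le_ofReal ?_
  rw [← mul_le_mul_iff_right₀ (Real.exp_pos (-(n * (l / 4)))), ← Real.exp_add]
  refine hle.trans_eq ?_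
  congr 1
  ring

section FBM

variable {Ω : Type*} [MeasurableSpace Ω] {P : Measure Ω} {H : ℝ} {X : Ω → ℝ → ℝ}

lemma IsFBM.exists_map_sum_eq (hX : IsFBM P H X) {ι : Type*} [Fintype ι] (t coef : ι → ℝ)
    (ht : ∀ i, 0 ≤ t i) :
    ∃ v : ℝ≥0, P.map (fun ω => ∑ i, coef i * X ω (t i)) = gaussianReal 0 v := by
  obtain ⟨v, hv⟩ := hX.2.2.2.1 (Fintype.card ι) (t ∘ (Fintype.equivFin ι).symm)
    (coef ∘ (Fintype.equivFin ι).symm) (fun i => ht _)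
  refine ⟨v, ?_⟩
  rw [← hv]
  congr 1
  ext ω
  exact ((Fintype.equivFin ι).symm.sum_comp (fun i => coef i * X ω (t i))).symm

lemma IsFBM.memLp_two (hX : IsFBM P H X) {t : ℝ} (ht : 0 ≤ t) :
    MemLp (fun ω => X ω t) 2 P := by
  obtain ⟨v, hv⟩ := hX.exists_map_sum_eq (fun _ : Unit => t) (fun _ => 1) (fun _ => ht)
  simp only [Finset.univ_unique, one_mul, Finset.sum_const, Finset.card_singleton, one_smul] at hv
  have := memLp_id_gaussianReal' (μ := 0) (v := v) 2 (by simp)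
  rw [← hv] at this
  exact (memLp_map_measure_iff (by fun_prop) (hX.1 t).aemeasurable).1 this

lemma IsFBM.integral_increment_mul (hX : IsFBM P H X) {s t s' t' : ℝ} (hs : 0 ≤ s) (ht : 0 ≤ t)
    (hs' : 0 ≤ s') (ht' : 0 ≤ t') :
    ∫ ω, (X ω t - X ω s) * (X ω t' - X ω s') ∂P =
      (|t' - s| ^ (2 * H) + |s' - t| ^ (2 * H) - |t' - t| ^ (2 * H) - |s' - s| ^ (2 * H)) / 2 := by
  have hi : ∀ {x y : ℝ}, 0 ≤ x → 0 ≤ y → Integrable (fun ω => X ω x * X ω y) P :=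
    fun hx hy => (hX.memLp_two hx).integrable_mul (hX.memLp_two hy)
  have h : ∀ ω, (X ω t - X ω s) * (X ω t' - X ω s')
      = (X ω t * X ω t' - X ω t * X ω s') - (X ω s * X ω t' - X ω s * X ω s') := fun ω => by ring
  simp_rw [h]
  have h1 : Integrable (fun ω => X ω t * X ω t' - X ω t * X ω s') P :=
    (hi ht ht').sub (hi ht hs')
  have h2 : Integrable (fun ω => X ω s * X ω t' - X ω s * X ω s') P :=
    (hi hs ht').sub (hi hs hs')
  rw [integral_sub h1 h2, integral_sub (hi ht ht') (hi ht hs'), integral_sub (hi hs ht') (hi hs hs')]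
  rw [hX.2.2.2.2 _ _ ht ht', hX.2.2.2.2 _ _ ht hs', hX.2.2.2.2 _ _ hs ht', hX.2.2.2.2 _ _ hs hs']
  ring

lemma IsFBM.map_sum_increments_eq (hX : IsFBM P H X) {ι : Type*} [Fintype ι]
    (s t coef : ι → ℝ) (hs : ∀ i, 0 ≤ s i) (ht : ∀ i, 0 ≤ t i) :
    ∃ v : ℝ≥0, P.map (fun ω => ∑ i, coef i * (X ω (t i) - X ω (s i))) = gaussianReal 0 v ∧
      (v : ℝ) = ∑ i, ∑ j, coef i * coef j * ((|t j - s i| ^ (2 * H) + |s j - t i| ^ (2 * H)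
        - |t j - t i| ^ (2 * H) - |s j - s i| ^ (2 * H)) / 2) := by
  obtain ⟨v, hv⟩ := hX.exists_map_sum_eq (Sum.elim t s) (Sum.elim coef (-coef))
    (by rintro (i | i) <;> simp [hs, ht])
  have hfun : (fun ω => ∑ i, Sum.elim coef (-coef) i * X ω (Sum.elim t s i))
      = fun ω => ∑ i, coef i * (X ω (t i) - X ω (s i)) := by
    ext ω
    simp_rw [mul_sub, Finset.sum_sub_distrib]
    simp [Fintype.sum_sum_type, sub_eq_add_neg]
  rw [hfun] at hv
  refine ⟨v, hv, ?_⟩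
  have hmeas : Measurable fun ω => ∑ i, coef i * (X ω (t i) - X ω (s i)) :=
    Finset.measurable_sum _ fun i _ => ((hX.1 _).sub (hX.1 _)).const_mul _
  have h1 : (v : ℝ) = ∫ ω, (∑ i, coef i * (X ω (t i) - X ω (s i))) ^ 2 ∂P := by
    have h2 := variance_eq_integral (μ := gaussianReal 0 v) measurable_id'.aemeasurable
    rw [variance_fun_id_gaussianReal, integral_id_gaussianReal] at h2
    rw [h2, ← hv, integral_map hmeas.aemeasurable (by fun_prop)]
    simp
  have hi : ∀ i j, Integrable (fun ω => (X ω (t i) - X ω (s i)) * (X ω (t j) - X ω (s j))) P :=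
    fun i j => ((hX.memLp_two (ht i)).sub (hX.memLp_two (hs i))).integrable_mul
      ((hX.memLp_two (ht j)).sub (hX.memLp_two (hs j)))
  have h3 : ∀ ω, (∑ i, coef i * (X ω (t i) - X ω (s i))) ^ 2 = ∑ i, ∑ j, coef i * coef j *
      ((X ω (t i) - X ω (s i)) * (X ω (t j) - X ω (s j))) := by
    intro ω
    rw [sq, Finset.sum_mul_sum]
    exact Finset.sum_congr rfl fun i _ => Finset.sum_congr rfl fun j _ => by ring
  simp_rw [h1, h3]
  rw [integral_finsetSum _ fun i _ => integrable_finsetSum _ fun j _ => (hi i j).const_mul _]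
  refine Finset.sum_congr rfl fun i _ => ?_
  rw [integral_finsetSum _ fun j _ => (hi i j).const_mul _]
  refine Finset.sum_congr rfl fun j _ => ?_
  rw [integral_const_mul, hX.integral_increment_mul (hs i) (ht i) (hs j) (ht j)]

end FBM

/-- A quadratic form with nonnegative row sums dominates the associated Dirichlet form. -/
lemma neg_half_sum_mul_sub_sq_le {ι : Type*} [Fintype ι] {M : ι → ι → ℝ}
    (hsymm : ∀ i j, M i j = M j i) (hrow : ∀ i, 0 ≤ ∑ j, M i j) (w : ι → ℝ) :
    -(∑ i, ∑ j, M i j * (w i - w j) ^ 2) / 2 ≤ ∑ i, ∑ j, w i * w j * M i j := by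
  have h1 : ∑ i, ∑ j, M i j * (w i - w j) ^ 2
      = ∑ i, ∑ j, M i j * w i ^ 2 + ∑ i, ∑ j, M i j * w j ^ 2
        - 2 * ∑ i, ∑ j, w i * w j * M i j := by
    rw [Finset.mul_sum, ← Finset.sum_add_distrib, ← Finset.sum_sub_distrib]
    refine Finset.sum_congr rfl fun i _ => ?_
    rw [Finset.mul_sum, ← Finset.sum_add_distrib, ← Finset.sum_sub_distrib]
    exact Finset.sum_congr rfl fun j _ => by ring
  have h2 : ∑ i, ∑ j, M i j * w j ^ 2 = ∑ i, ∑ j, M i j * w i ^ 2 := by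
    rw [Finset.sum_comm]
    exact Finset.sum_congr rfl fun i _ => Finset.sum_congr rfl fun j _ => by rw [hsymm]
  have h3 : 0 ≤ ∑ i, ∑ j, M i j * w i ^ 2 := by
    refine Finset.sum_nonneg fun i _ => ?_
    rw [← Finset.sum_mul]
    exact mul_nonneg (hrow i) (sq_nonneg _)
  linarith

/-- Covariance at lag `x` of fractional Gaussian noise, with `α` twice the Hurst parameter. -/
noncomputable def fgnCov (α x : ℝ) : ℝ := (|x + 1| ^ α + |x - 1| ^ α - 2 * |x| ^ α) / 2

lemma fgnCov_neg (α x : ℝ) : fgnCov α (-x) = fgnCov α x := by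
  unfold fgnCov
  rw [abs_neg, show -x + 1 = -(x - 1) by ring, show -x - 1 = -(x + 1) by ring, abs_neg, abs_neg]
  ring

lemma fgnCov_one {α : ℝ} (hα : 0 < α) : fgnCov α 1 = (2 ^ α - 2) / 2 := by
  unfold fgnCov
  norm_num [Real.zero_rpow hα.ne']

lemma fgnCov_nonpos_of_one_le {α x : ℝ} (h0 : 0 ≤ α) (h1 : α ≤ 1) (hx : 1 ≤ x) :
    fgnCov α x ≤ 0 := by
  have hx1 : x + 1 ∈ Set.Ici (0 : ℝ) := Set.mem_Ici.2 (by linarith)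
  have hx2 : x - 1 ∈ Set.Ici (0 : ℝ) := Set.mem_Ici.2 (by linarith)
  obtain ⟨-, hconc⟩ := Real.concaveOn_rpow h0 h1
  have h := hconc hx1 hx2 (by norm_num : (0 : ℝ) ≤ 1 / 2) (by norm_num : (0 : ℝ) ≤ 1 / 2)
    (by norm_num)
  simp only [smul_eq_mul] at h
  rw [show 1 / 2 * (x + 1) + 1 / 2 * (x - 1) = x by ring] at h
  unfold fgnCov
  rw [abs_of_nonneg (by linarith : 0 ≤ x + 1), abs_of_nonneg (by linarith : 0 ≤ x - 1),
    abs_of_nonneg (by linarith : 0 ≤ x)]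
  linarith

lemma fgnCov_natCast_sub_nonpos {α : ℝ} (h0 : 0 ≤ α) (h1 : α ≤ 1) {p q : ℕ} (hpq : p ≠ q) :
    fgnCov α ((q : ℝ) - p) ≤ 0 := by
  rcases lt_or_gt_of_ne hpq with h | h
  · refine fgnCov_nonpos_of_one_le h0 h1 ?_
    have : (p : ℝ) + 1 ≤ q := by exact_mod_cast h
    linarith
  · rw [← neg_sub, fgnCov_neg]
    refine fgnCov_nonpos_of_one_le h0 h1 ?_
    have : (q : ℝ) + 1 ≤ p := by exact_mod_cast h
    linarith

lemma sum_fgnCov_nonneg {α : ℝ} (h0 : 0 ≤ α) {m p : ℕ} (hp : p < 2 * m) :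
    0 ≤ ∑ k : Fin m, (fgnCov α (2 * (k : ℕ) - p) + fgnCov α (2 * (k : ℕ) + 1 - p)) := by
  let ψ : ℕ → ℝ := fun k => (|2 * (k : ℝ) - p - 1| ^ α - |2 * (k : ℝ) - p| ^ α) / 2
  have h : ∀ k : ℕ, fgnCov α (2 * k - p) + fgnCov α (2 * k + 1 - p) = ψ k - ψ (k + 1) := by
    intro k
    simp only [ψ, fgnCov]
    push_cast
    ring_nf
  rw [Fin.sum_univ_eq_sum_range
    (fun k : ℕ => fgnCov α (2 * (k : ℝ) - p) + fgnCov α (2 * (k : ℝ) + 1 - p))]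
  simp_rw [h]
  rw [Finset.sum_range_sub']
  have hp' : (p : ℝ) + 1 ≤ 2 * m := by exact_mod_cast hp
  have hp0 : (0 : ℝ) ≤ p := p.cast_nonneg
  have e1 : ψ m ≤ 0 := by
    simp only [ψ]
    rw [abs_of_nonneg (by linarith : 0 ≤ 2 * (m : ℝ) - p - 1),
      abs_of_nonneg (by linarith : 0 ≤ 2 * (m : ℝ) - p)]
    have := Real.rpow_le_rpow (by linarith : 0 ≤ 2 * (m : ℝ) - p - 1)
      (by linarith : 2 * (m : ℝ) - p - 1 ≤ 2 * (m : ℝ) - p) h0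
    linarith
  have e2 : 0 ≤ ψ 0 := by
    simp only [ψ]
    have hle : |2 * ((0 : ℕ) : ℝ) - p| ≤ |2 * ((0 : ℕ) : ℝ) - p - 1| := by
      rw [abs_of_nonpos (by push_cast; linarith), abs_of_nonpos (by push_cast; linarith)]
      push_cast
      linarith
    have := Real.rpow_le_rpow (abs_nonneg _) hle h0
    exact div_nonneg (sub_nonneg.2 this) zero_le_two
  linarith

/-- Variance lower bound for alternating combinations of fractional Gaussian noise. -/
lemma le_sum_sum_mul_fgnCov {α : ℝ} (h0 : 0 < α) (h1 : α ≤ 1) {m : ℕ} (u : Fin m → ℝ) :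
    (4 - 2 * 2 ^ α) * ∑ j, u j ^ 2 ≤ ∑ x : Fin m × Bool, ∑ y : Fin m × Bool,
      (if x.2 then u x.1 else -u x.1) * (if y.2 then u y.1 else -u y.1) *
        fgnCov α (((2 * y.1 + y.2.toNat : ℕ) : ℝ) - ((2 * x.1 + x.2.toNat : ℕ) : ℝ)) := by
  let idx : Fin m × Bool → ℕ := fun x => 2 * x.1 + x.2.toNat
  let w : Fin m × Bool → ℝ := fun x => if x.2 then u x.1 else -u x.1
  let M : Fin m × Bool → Fin m × Bool → ℝ := fun x y => fgnCov α ((idx y : ℝ) - idx x)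
  have hidx : Function.Injective idx := by
    rintro ⟨i, b⟩ ⟨j, c⟩ h
    cases b <;> cases c <;> simp [idx] at h ⊢ <;> omega
  have hlt : ∀ x, idx x < 2 * m := by
    rintro ⟨i, b⟩
    have := i.2
    cases b
    · simp [idx]
    · simp [idx]
      omega
  have hsymm : ∀ x y, M x y = M y x := fun x y => by
    simp only [M]
    rw [← neg_sub, fgnCov_neg]
  have hrow : ∀ x, 0 ≤ ∑ y, M x y := by
    intro x
    have := sum_fgnCov_nonneg h0.le (hlt x)
    rw [Fintype.sum_prod_type]
    simpa [M, idx, add_comm] using this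
  refine le_trans ?_ (neg_half_sum_mul_sub_sq_le hsymm hrow w)
  have hterm : ∀ x y, M x y * (w x - w y) ^ 2 ≤ 0 := by
    intro x y
    by_cases h : x = y
    · simp [h]
    · exact mul_nonpos_of_nonpos_of_nonneg
        (fgnCov_natCast_sub_nonpos h0.le h1 (hidx.ne h)) (sq_nonneg _)
  have hinner : ∀ i b, ∑ y, M (i, b) y * (w (i, b) - w y) ^ 2
      ≤ ((2 ^ α - 2) / 2) * (4 * u i ^ 2) := by
    intro i b
    rw [← Finset.add_sum_erase _ _ (Finset.mem_univ (i, !b))]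
    have h2 : ∑ y ∈ Finset.univ.erase (i, !b), M (i, b) y * (w (i, b) - w y) ^ 2 ≤ 0 :=
      Finset.sum_nonpos fun y _ => hterm _ _
    have h3 : M (i, b) (i, !b) * (w (i, b) - w (i, !b)) ^ 2
        = ((2 ^ α - 2) / 2) * (4 * u i ^ 2) := by
      rw [← fgnCov_one h0]
      cases b
      · simp [M, idx, w]
        left; ring
      · simp [M, idx, w, fgnCov_neg]
        left; ring
    linarith
  have hsum : ∑ x, ∑ y, M x y * (w x - w y) ^ 2
      ≤ ∑ x : Fin m × Bool, ((2 ^ α - 2) / 2) * (4 * u x.1 ^ 2) :=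
    Finset.sum_le_sum fun x _ => hinner x.1 x.2
  have : ∑ x : Fin m × Bool, ((2 ^ α - 2) / 2) * (4 * u x.1 ^ 2)
      = 2 * (2 * 2 ^ α - 4) * ∑ i, u i ^ 2 := by
    rw [Fintype.sum_prod_type, Finset.mul_sum]
    refine Finset.sum_congr rfl fun i _ => ?_
    rw [Fintype.sum_bool]
    ring
  linarith

/-- Normalized second differences of fractional Brownian motion along a grid of mesh `δ`, over
disjoint blocks, are jointly Gaussian with uniformly nondegenerate covariance. -/
lemma IsFBM.map_sum_second_differences {Ω : Type*} [MeasurableSpace Ω] {P : Measure Ω} {H : ℝ}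
    {X : Ω → ℝ → ℝ} (hX : IsFBM P H X) (hH : H ∈ Set.Ioo (0 : ℝ) (1 / 2)) {δ : ℝ} (hδ : 0 < δ)
    {m : ℕ} (u : Fin m → ℝ) :
    ∃ v : ℝ≥0, P.map (fun ω => ∑ j : Fin m, u j *
        (((X ω ((2 * (j : ℕ) + 1 + 1) * δ) - X ω ((2 * (j : ℕ) + 1) * δ))
          - (X ω ((2 * (j : ℕ) + 1) * δ) - X ω (2 * (j : ℕ) * δ))) / δ ^ H)) = gaussianReal 0 v ∧
      (4 - 2 * 2 ^ (2 * H)) * ∑ j, u j ^ 2 ≤ v := by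
  let idx : Fin m × Bool → ℕ := fun x => 2 * x.1 + x.2.toNat
  let w : Fin m × Bool → ℝ := fun x => if x.2 then u x.1 else -u x.1
  obtain ⟨v, hv, hv'⟩ := hX.map_sum_increments_eq (fun x => (idx x : ℝ) * δ)
    (fun x => ((idx x : ℝ) + 1) * δ) (fun x => w x / δ ^ H)
    (fun x => by positivity) (fun x => by positivity)
  refine ⟨v, ?_, ?_⟩
  · rw [← hv]
    congr 1
    ext ω
    rw [Fintype.sum_prod_type]
    refine Finset.sum_congr rfl fun j _ => ?_
    simp [idx, w]
    ring
  · refine (le_sum_sum_mul_fgnCov (by linarith [hH.1]) (by linarith [hH.2]) u).trans_eq ?_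
    rw [hv']
    refine Finset.sum_congr rfl fun x _ => Finset.sum_congr rfl fun y _ => ?_
    have habs : ∀ z : ℝ, |z * δ| ^ (2 * H) = |z| ^ (2 * H) * (δ ^ H * δ ^ H) := by
      intro z
      rw [abs_mul, abs_of_pos hδ, Real.mul_rpow (abs_nonneg _) hδ.le, two_mul H,
        Real.rpow_add hδ]
    have hδH : δ ^ H ≠ 0 := (Real.rpow_pos_of_pos hδ H).ne'
    simp only [← sub_mul, habs]
    change w x * w y * fgnCov (2 * H) ((idx y : ℝ) - idx x) = _
    unfold fgnCov
    rw [show (idx y : ℝ) + 1 - idx x = idx y - idx x + 1 by ring,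
      show (idx y : ℝ) - (idx x + 1) = idx y - idx x - 1 by ring,
      show (idx y : ℝ) + 1 - (idx x + 1) = idx y - idx x by ring]
    field_simp
    ring

/-- Dyadic chaining: a continuous path whose dyadic increments at level `n` are at most `K * r ^ n`,
with `r = 2 ^ (-β)`, has finite `β`-Hölder seminorm. -/
lemma bddAbove_holder_of_dyadic {f : ℝ → ℝ} {T β K : ℝ} (hT : 0 < T) (hβ : 0 < β)
    (hf : ContinuousOn f (Set.Ici 0))
    (hK : ∀ n k : ℕ, k < 2 ^ n →
      |f (((k : ℝ) + 1) * (T / 2 ^ n)) - f (k * (T / 2 ^ n))| ≤ K * ((2 : ℝ) ^ (-β)) ^ n) :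
    BddAbove {x : ℝ | ∃ s t : ℝ, 0 ≤ s ∧ s < t ∧ t ≤ T ∧ x = |f t - f s| / (t - s) ^ β} := by
  set r : ℝ := (2 : ℝ) ^ (-β) with hr
  have hr0 : 0 < r := Real.rpow_pos_of_pos two_pos _
  have hr1 : r < 1 := Real.rpow_lt_one_of_one_lt_of_neg one_lt_two (by linarith)
  have hK0 : 0 ≤ K := by
    have := (abs_nonneg _).trans (hK 0 0 (by norm_num))
    simpa using this
  have hpow : ∀ n : ℕ, (0 : ℝ) < 2 ^ n := fun n => by positivity
  let κ : ℕ → ℝ → ℕ := fun n t => ⌊t * 2 ^ n / T⌋₊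
  let τ : ℕ → ℝ → ℝ := fun n t => κ n t * (T / 2 ^ n)
  have hκ_le : ∀ n t, t ≤ T → κ n t ≤ 2 ^ n := by
    intro n t ht
    refine Nat.floor_le_of_le ?_
    push_cast
    rw [div_le_iff₀ hT]
    nlinarith [hpow n]
  have hstep : ∀ n k l : ℕ, k ≤ l → l ≤ k + 1 → l ≤ 2 ^ n →
      |f (l * (T / 2 ^ n)) - f (k * (T / 2 ^ n))| ≤ K * r ^ n := by
    intro n k l h1 h2 h3
    obtain rfl | rfl : l = k ∨ l = k + 1 := by omega
    · simpa using mul_nonneg hK0 (pow_nonneg hr0.le n)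
    · simpa using hK n k (by omega)
  have happrox : ∀ t, 0 ≤ t → t ≤ T → ∀ n, |f (τ n t) - f t| ≤ K * r ^ n / (1 - r) := by
    intro t h0 ht n
    have hnear : ∀ n, 0 ≤ τ n t ∧ τ n t ≤ t ∧ t - T * (1 / 2) ^ n ≤ τ n t := by
      intro n
      have h1 := Nat.floor_le (a := t * 2 ^ n / T) (by positivity)
      have h2 := (Nat.lt_floor_add_one (t * 2 ^ n / T)).le
      have e : t = t * 2 ^ n / T * (T / 2 ^ n) := by field_simp
      have e' : T * (1 / 2) ^ n = T / 2 ^ n := by rw [one_div, inv_pow, div_eq_mul_inv]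
      have hpos : 0 < T / 2 ^ n := div_pos hT (hpow n)
      refine ⟨by positivity, ?_, ?_⟩
      · calc τ n t ≤ t * 2 ^ n / T * (T / 2 ^ n) := by simp only [τ, κ]; gcongr
          _ = t := e.symm
      · have h3 := mul_le_mul_of_nonneg_right h2 hpos.le
        rw [← e] at h3
        rw [e']
        simp only [τ, κ]
        linarith
    have hlim : Tendsto (fun n => τ n t) atTop (𝓝 t) := by
      refine tendsto_of_tendsto_of_tendsto_of_le_of_le ?_ tendsto_const_nhds
        (fun n => (hnear n).2.2) (fun n => (hnear n).2.1)
      have := (tendsto_pow_atTop_nhds_zero_of_lt_one (by norm_num : (0 : ℝ) ≤ 1 / 2)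
        (by norm_num)).const_mul T
      simpa using tendsto_const_nhds.sub this
    have hflim : Tendsto (fun n => f (τ n t)) atTop (𝓝 (f t)) :=
      (hf t h0).tendsto.comp (tendsto_nhdsWithin_iff.2
        ⟨hlim, Eventually.of_forall fun n => (hnear n).1⟩)
    refine dist_le_of_le_geometric_of_tendsto r K hr1 (fun n => ?_) hflim n
    rw [dist_comm, Real.dist_eq]
    have hx : 0 ≤ t * 2 ^ n / T := by positivity
    have e1 : t * 2 ^ (n + 1) / T = 2 * (t * 2 ^ n / T) := by ring
    have h1 : 2 * κ n t ≤ κ (n + 1) t := by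
      refine Nat.le_floor ?_
      rw [e1]
      push_cast
      linarith [Nat.floor_le hx]
    have h2 : κ (n + 1) t ≤ 2 * κ n t + 1 := by
      refine Nat.lt_succ_iff.1 ((Nat.floor_lt (by positivity)).2 ?_)
      rw [e1]
      push_cast
      linarith [Nat.lt_floor_add_one (t * 2 ^ n / T)]
    have h3 := hstep (n + 1) _ _ h1 h2 (hκ_le _ _ ht)
    have e2 : ((2 * κ n t : ℕ) : ℝ) * (T / 2 ^ (n + 1)) = τ n t := by
      simp only [τ]
      push_cast
      rw [pow_succ]
      field_simp
    rw [e2] at h3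
    refine h3.trans (mul_le_mul_of_nonneg_left ?_ hK0)
    exact pow_le_pow_of_le_one hr0.le hr1.le (Nat.le_succ n)
  refine ⟨K * (1 + 2 / (1 - r)) / (T ^ β * r), ?_⟩
  rintro x ⟨s, t, hs, hst, htT, rfl⟩
  obtain ⟨n, hn1, hn2⟩ := exists_nat_pow_near_of_lt_one (x := (t - s) / T) (y := (1 / 2 : ℝ))
    (div_pos (by linarith) hT) ((div_le_one hT).2 (by linarith)) (by norm_num) (by norm_num)
  have hlow : T ^ β * r * r ^ n ≤ (t - s) ^ β := by
    have h1 : T * (1 / 2) ^ (n + 1) ≤ t - s := by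
      rw [lt_div_iff₀ hT] at hn1
      linarith
    have h2 : ((1 / 2 : ℝ) ^ (n + 1)) ^ β = r * r ^ n := by
      rw [← pow_succ', hr, ← Real.rpow_natCast, ← Real.rpow_mul (by norm_num), mul_comm,
        Real.rpow_mul (by norm_num), Real.rpow_natCast, one_div,
        Real.inv_rpow (by norm_num), Real.rpow_neg (by norm_num)]
    calc T ^ β * r * r ^ n = (T * (1 / 2) ^ (n + 1)) ^ β := by
          rw [Real.mul_rpow hT.le (by positivity), h2, mul_assoc]
      _ ≤ _ := Real.rpow_le_rpow (by positivity) h1 hβ.le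
  have hup : |f t - f s| ≤ K * (1 + 2 / (1 - r)) * r ^ n := by
    have hs' := happrox s hs (by linarith) n
    have ht' := happrox t (by linarith) htT n
    have hxs : 0 ≤ s * 2 ^ n / T := by positivity
    have h1 : κ n s ≤ κ n t := Nat.floor_le_floor (by gcongr)
    have h2 : κ n t ≤ κ n s + 1 := by
      rw [← Nat.floor_add_one hxs]
      refine Nat.floor_le_floor ?_
      have h4 : (t - s) * 2 ^ n / T ≤ 1 := by
        rw [one_div, inv_pow, ← one_div, le_div_iff₀ (hpow n)] at hn2
        calc (t - s) * 2 ^ n / T = (t - s) / T * 2 ^ n := by ring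
          _ ≤ 1 := hn2
      have h5 : (t - s) * 2 ^ n / T = t * 2 ^ n / T - s * 2 ^ n / T := by ring
      linarith
    have h3 : |f (τ n t) - f (τ n s)| ≤ K * r ^ n := hstep n _ _ h1 h2 (hκ_le n t htT)
    have e : K * (1 + 2 / (1 - r)) * r ^ n
        = K * r ^ n + K * r ^ n / (1 - r) + K * r ^ n / (1 - r) := by ring
    rw [e]
    rw [abs_le] at *
    constructor <;> linarith [hs'.1, hs'.2, ht'.1, ht'.2, h3.1, h3.2]
  have hTβ : 0 < T ^ β := Real.rpow_pos_of_pos hT _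
  have hbase : 0 < (t - s) ^ β := Real.rpow_pos_of_pos (by linarith) _
  rw [div_le_div_iff₀ hbase (by positivity)]
  have hc : 0 ≤ K * (1 + 2 / (1 - r)) := by
    have : 0 < 1 - r := by linarith
    positivity
  calc |f t - f s| * (T ^ β * r) ≤ K * (1 + 2 / (1 - r)) * r ^ n * (T ^ β * r) := by gcongr
    _ = K * (1 + 2 / (1 - r)) * (T ^ β * r * r ^ n) := by ring
    _ ≤ _ := by gcongr

lemma lintegral_abs_pow_gaussianReal (q : ℕ) {σ : ℝ} (hσ : 0 ≤ σ) {v : ℝ≥0} (hv : (v : ℝ) = σ ^ 2) :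
    ∫⁻ x, ENNReal.ofReal (|x| ^ q) ∂gaussianReal 0 v
      = ENNReal.ofReal (σ ^ q) * ∫⁻ x, ENNReal.ofReal (|x| ^ q) ∂gaussianReal 0 1 := by
  have h : gaussianReal 0 v = (gaussianReal 0 1).map (fun x => σ * x) := by
    rw [gaussianReal_map_const_mul, mul_zero, mul_one]
    congr 1
    exact NNReal.eq hv
  rw [h, lintegral_map (by fun_prop) (by fun_prop), ← lintegral_const_mul _ (by fun_prop)]
  refine lintegral_congr fun x => ?_
  rw [← ENNReal.ofReal_mul (by positivity), abs_mul, mul_pow, abs_of_nonneg hσ]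

lemma lintegral_abs_pow_stdGaussian_ne_top (q : ℕ) :
    ∫⁻ x, ENNReal.ofReal (|x| ^ q) ∂gaussianReal 0 1 ≠ ∞ := by
  have h := (memLp_id_gaussianReal' (μ := 0) (v := 1) (q : ℝ≥0∞) (by simp)).integrable_norm_pow'
  have h' := h.lintegral_lt_top
  simpa using h'.ne

/-- Sample paths of fractional Brownian motion are almost surely `β`-Hölder for `β < H`. -/
lemma IsFBM.ae_bddAbove {Ω : Type*} [MeasurableSpace Ω] {P : Measure Ω} {H : ℝ}
    {X : Ω → ℝ → ℝ} (hX : IsFBM P H X) {β T : ℝ} (hT : 0 < T) (hβ : 0 < β) (hβH : β < H) :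
    ∀ᵐ ω ∂P, BddAbove {x : ℝ | ∃ s t : ℝ, 0 ≤ s ∧ s < t ∧ t ≤ T ∧
      x = |X ω t - X ω s| / (t - s) ^ β} := by
  set r : ℝ := (2 : ℝ) ^ (-β) with hr
  have hr0 : 0 < r := Real.rpow_pos_of_pos two_pos _
  set ρ : ℝ := (2 : ℝ) ^ (β - H) with hρ
  have hρ0 : 0 < ρ := Real.rpow_pos_of_pos two_pos _
  have hρ1 : ρ < 1 := Real.rpow_lt_one_of_one_lt_of_neg one_lt_two (by linarith)
  obtain ⟨q, hq⟩ := exists_pow_lt_of_lt_one (by norm_num : (0 : ℝ) < 1 / 2) hρ1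
  have hq0 : q ≠ 0 := by
    rintro rfl
    norm_num at hq
  let Y : ℕ → ℕ → Ω → ℝ := fun n k ω =>
    X ω (((k : ℝ) + 1) * (T / 2 ^ n)) - X ω (k * (T / 2 ^ n))
  have hYm : ∀ n k, Measurable (Y n k) := fun n k => (hX.1 _).sub (hX.1 _)
  have hscale : ∀ n : ℕ, (T / 2 ^ n) ^ H = T ^ H * ρ ^ n * r ^ n := by
    intro n
    have h1 : ρ * r = (2 ^ H)⁻¹ := by
      rw [hρ, hr, ← Real.rpow_add two_pos, ← Real.rpow_neg zero_le_two]
      congr 1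
      ring
    rw [mul_assoc, ← mul_pow, h1, Real.div_rpow hT.le (by positivity), inv_pow, div_eq_mul_inv,
      ← Real.rpow_natCast, ← Real.rpow_natCast, ← Real.rpow_mul zero_le_two,
      ← Real.rpow_mul zero_le_two, mul_comm H]
  set C := ∫⁻ x, ENNReal.ofReal (|x| ^ q) ∂gaussianReal 0 1 with hC
  have hmoment : ∀ n k, ∫⁻ ω, ENNReal.ofReal ((|Y n k ω| / r ^ n) ^ q) ∂P
      = ENNReal.ofReal ((T ^ H) ^ q * (ρ ^ q) ^ n) * C := by
    intro n k
    have hpos : 0 < T / 2 ^ n := by positivity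
    obtain ⟨v, hv, hv'⟩ := hX.map_sum_increments_eq (fun _ : Unit => (k : ℝ) * (T / 2 ^ n))
      (fun _ => ((k : ℝ) + 1) * (T / 2 ^ n)) (fun _ => (r ^ n)⁻¹)
      (fun _ => by positivity) (fun _ => by positivity)
    simp only [Finset.univ_unique, Finset.sum_const, Finset.card_singleton, one_smul] at hv hv'
    have hσ : (v : ℝ) = (T ^ H * ρ ^ n) ^ 2 := by
      have hH : 2 * H ≠ 0 := by linarith
      have habs : |((k : ℝ) + 1) * (T / 2 ^ n) - k * (T / 2 ^ n)| = T / 2 ^ n := by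
        rw [← sub_mul, add_sub_cancel_left, one_mul, abs_of_pos hpos]
      rw [hv', abs_sub_comm ((k : ℝ) * (T / 2 ^ n)) (((k : ℝ) + 1) * (T / 2 ^ n)), habs]
      simp only [sub_self, abs_zero, Real.zero_rpow hH]
      rw [two_mul H, Real.rpow_add hpos, hscale]
      field_simp
      ring
    have h1 := lintegral_abs_pow_gaussianReal q (by positivity) hσ
    rw [← hv, lintegral_map (by fun_prop) ((hYm n k).const_mul _)] at h1
    rw [hC, pow_right_comm, ← mul_pow, ← h1]
    refine lintegral_congr fun ω => ?_
    rw [abs_mul, abs_of_pos (inv_pos.2 (pow_pos hr0 n)), div_eq_inv_mul]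
  have hfin : ∫⁻ ω, ∑' n : ℕ, ∑ k ∈ Finset.range (2 ^ n),
      ENNReal.ofReal ((|Y n k ω| / r ^ n) ^ q) ∂P ≠ ∞ := by
    rw [lintegral_tsum fun n => (Finset.measurable_sum _ fun k _ => by
      have := hYm n k; fun_prop).aemeasurable]
    have h1 : ∀ n : ℕ, ∫⁻ ω, ∑ k ∈ Finset.range (2 ^ n),
        ENNReal.ofReal ((|Y n k ω| / r ^ n) ^ q) ∂P
        = ENNReal.ofReal ((T ^ H) ^ q) * C * ENNReal.ofReal (2 * ρ ^ q) ^ n := by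
      intro n
      rw [lintegral_finsetSum _ fun k _ => by have := hYm n k; fun_prop]
      simp_rw [hmoment]
      rw [Finset.sum_const, Finset.card_range, nsmul_eq_mul, ENNReal.ofReal_mul (by positivity),
        ENNReal.ofReal_mul zero_le_two, mul_pow, ENNReal.ofReal_pow (by positivity) n]
      push_cast
      rw [ENNReal.ofReal_ofNat]
      ring
    simp_rw [h1]
    rw [ENNReal.tsum_mul_left, ENNReal.tsum_geometric]
    refine ENNReal.mul_ne_top (ENNReal.mul_ne_top ENNReal.ofReal_ne_top
      (lintegral_abs_pow_stdGaussian_ne_top q)) (ENNReal.inv_ne_top.2 (tsub_pos_of_lt ?_).ne')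
    rw [← ENNReal.ofReal_one]
    exact (ENNReal.ofReal_lt_ofReal_iff one_pos).2 (by linarith)
  have hae := ae_lt_top' (Measurable.aemeasurable <| Measurable.tsum fun n =>
    Finset.measurable_sum _ fun k _ => by have := hYm n k; fun_prop) hfin
  filter_upwards [hae, hX.2.2.1] with ω hω hcont
  set S := ∑' n : ℕ, ∑ k ∈ Finset.range (2 ^ n), ENNReal.ofReal ((|Y n k ω| / r ^ n) ^ q) with hS
  refine bddAbove_holder_of_dyadic (K := max 1 S.toReal) hT hβ hcont fun n k hk => ?_
  have h1 : ENNReal.ofReal ((|Y n k ω| / r ^ n) ^ q) ≤ S :=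
    (Finset.single_le_sum (f := fun k => ENNReal.ofReal ((|Y n k ω| / r ^ n) ^ q))
      (fun _ _ => zero_le) (Finset.mem_range.2 hk)).trans (ENNReal.le_tsum n)
  have h2 := (ENNReal.ofReal_le_iff_le_toReal hω.ne).1 h1
  rw [← div_le_iff₀ (pow_pos hr0 n)]
  change |Y n k ω| / r ^ n ≤ _
  rcases le_total (|Y n k ω| / r ^ n) 1 with h | h
  · exact h.trans (le_max_left _ _)
  · exact ((le_self_pow₀ h hq0).trans h2).trans (le_max_right _ _)

/-- **Small deviation for fractional Brownian motion in the `β`-Hölder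
seminorm, `H < 1/2`, `β ∈ (0,H)`.**  There are constants `C₁, C₂ > 0`
(possibly depending on `H`, `β` and `T` but not on `ε`) such that for every
`ε ∈ (0,1)`, `P(‖B^H‖_β ≤ ε) ≤ C₁·exp(−C₂·ε^{−1/(H−β)})`. -/
theorem small_deviation_fbm_holder_norm
    (H : ℝ) (hH : H ∈ Set.Ioo (0:ℝ) (1/2)) (T : ℝ) (hT : 0 < T)
    {Ω : Type*} [MeasurableSpace Ω] (P : Measure Ω) [IsProbabilityMeasure P]
    (X : Ω → ℝ → ℝ) (hX : IsFBM P H X)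
    (β : ℝ) (hβ : β ∈ Set.Ioo (0:ℝ) H) :
    ∃ C₁ C₂ : ℝ, 0 < C₁ ∧ 0 < C₂ ∧
      ∀ ε ∈ Set.Ioo (0:ℝ) 1,
        P {ω | holderSemiNorm T β (X ω) ≤ ε}
          ≤ ENNReal.ofReal (C₁ * Real.exp (-(C₂ * ε ^ (-(1 / (H - β)))))) := by
  obtain ⟨hH0, hH1⟩ := hH
  obtain ⟨hβ0, hβH⟩ := hβ
  have hγ : 0 < H - β := by linarith
  have h2H : (2 : ℝ) ^ (2 * H) < 2 := by
    conv_rhs => rw [← Real.rpow_one 2]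
    exact Real.rpow_lt_rpow_of_exponent_lt one_lt_two (by linarith)
  set a : ℝ := 4 - 2 * 2 ^ (2 * H) with ha
  have ha0 : 0 < a := by linarith
  set l : ℝ := Real.log (1 + a) with hl
  have hl0 : 0 < l := Real.log_pos (by linarith)
  set c : ℝ := √(l / 2) with hc
  have hc0 : 0 < c := Real.sqrt_pos.2 (by linarith)
  set κ : ℝ := (2 / c) ^ (1 / (H - β)) with hκ
  have hκ0 : 0 < κ := Real.rpow_pos_of_pos (by positivity) _
  refine ⟨Real.exp (l / 4), T / (2 * κ) * (l / 4), Real.exp_pos _, by positivity, ?_⟩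
  rintro ε ⟨hε0, -⟩
  set δ : ℝ := κ * ε ^ (1 / (H - β)) with hδ
  have hδ0 : 0 < δ := mul_pos hκ0 (Real.rpow_pos_of_pos hε0 _)
  have hδpow : δ ^ (H - β) = 2 / c * ε := by
    rw [hδ, hκ, ← Real.mul_rpow (by positivity) hε0.le, ← Real.rpow_mul (by positivity),
      one_div_mul_cancel hγ.ne', Real.rpow_one]
  have hδH : 2 * (ε * δ ^ β) / δ ^ H = c := by
    rw [show H = (H - β) + β by ring, Real.rpow_add hδ0, hδpow]
    have := (Real.rpow_pos_of_pos hδ0 β).ne'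
    field_simp
  set m : ℕ := ⌊T / (2 * δ)⌋₊ with hm
  have hmT : 2 * (m : ℝ) * δ ≤ T := by
    have := Nat.floor_le (a := T / (2 * δ)) (by positivity)
    rw [le_div_iff₀ (by positivity)] at this
    linarith
  let D : Fin m → Ω → ℝ := fun j ω =>
    ((X ω ((2 * (j : ℕ) + 1 + 1) * δ) - X ω ((2 * (j : ℕ) + 1) * δ))
      - (X ω ((2 * (j : ℕ) + 1) * δ) - X ω (2 * (j : ℕ) * δ))) / δ ^ H
  have hDm : ∀ j, Measurable (D j) := fun j =>
    (((hX.1 _).sub (hX.1 _)).sub ((hX.1 _).sub (hX.1 _))).div_const _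
  have hball := measure_forall_abs_le_le (P := P) hDm ha0.le
    (fun u => hX.map_sum_second_differences ⟨hH0, hH1⟩ hδ0 u)
  have hsub : {ω | holderSemiNorm T β (X ω) ≤ ε} ≤ᵐ[P] {ω | ∀ j, |D j ω| ≤ c} := by
    filter_upwards [hX.ae_bddAbove hT hβ0 hβH] with ω hbdd hω j
    have hincr : ∀ x : ℝ, 0 ≤ x → (x + 1) * δ ≤ T →
        |X ω ((x + 1) * δ) - X ω (x * δ)| ≤ ε * δ ^ β := by
      intro x hx hxT
      have h1 := (le_csSup hbdd ⟨x * δ, (x + 1) * δ, by positivity, by linarith, hxT, rfl⟩).trans hω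
      rwa [show (x + 1) * δ - x * δ = δ by ring,
        div_le_iff₀ (Real.rpow_pos_of_pos hδ0 β)] at h1
    have hj : (j : ℝ) + 1 ≤ m := by exact_mod_cast j.2
    have hj0 : (0 : ℝ) ≤ (j : ℕ) := Nat.cast_nonneg _
    have hb1 := hincr (2 * (j : ℕ) + 1) (by linarith) (by nlinarith)
    have hb2 := hincr (2 * (j : ℕ)) (by linarith) (by nlinarith)
    simp only [D]
    rw [abs_div, abs_of_pos (Real.rpow_pos_of_pos hδ0 H), ← hδH]
    gcongr
    exact (abs_sub _ _).trans (by linarith)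
  refine (measure_mono_ae hsub).trans (hball.trans (ENNReal.ofReal_le_ofReal ?_))
  rw [← Real.exp_add, Real.exp_le_exp, Fintype.card_fin]
  have hmge : T / (2 * δ) - 1 ≤ m := by
    linarith [Nat.lt_floor_add_one (T / (2 * δ))]
  have hTδ : T / (2 * κ) * ε ^ (-(1 / (H - β))) = T / (2 * δ) := by
    rw [hδ, Real.rpow_neg hε0.le]
    have := (Real.rpow_pos_of_pos hε0 (1 / (H - β))).ne'
    field_simp
  have := mul_le_mul_of_nonneg_right hmge (by linarith : 0 ≤ l / 4)
  rw [← hTδ] at this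
  linarith
end
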